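/- arXiv:2002.01569 — 2 statements merged into one kernel-verified Lean document; each statement's English description precedes it below -/
import Mathlib

section
/- There exists a universal constant C₀ (independent of the dimension p, the domain Ω, the correlation function Ψ, the variance σ², the number of design points n, and the choice of design points) such that E[M] ≤ C₀ √(p · (1 ∨ log(A₀ D_Ω))), where M = sup_{x∈Ω} (Z(x) − μ(x)) / (σ(x) · log^{1/2}(e σ / σ(x))) with the convention 0/0 = 0, and a ∨ b denotes max(a,b). -/
open MeasureTheory ProbabilityTheory
open scoped RealInnerProductSpace

noncomputable def kmat {p n : ℕ} (Ψ : EuclideanSpace ℝ (Fin p) → ℝ)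
    (xs : Fin n → EuclideanSpace ℝ (Fin p)) : Matrix (Fin n) (Fin n) ℝ :=
  Matrix.of fun j k => Ψ (xs j - xs k)

noncomputable def kinterp {p n : ℕ} (Ψ : EuclideanSpace ℝ (Fin p) → ℝ)
    (xs : Fin n → EuclideanSpace ℝ (Fin p)) (f : EuclideanSpace ℝ (Fin p) → ℝ)
    (v : EuclideanSpace ℝ (Fin p)) : ℝ :=
  ∑ j, ∑ k, Ψ (v - xs j) * (kmat Ψ xs)⁻¹ j k * f (xs k)

noncomputable def krigSd {p n : ℕ} (Ψ : EuclideanSpace ℝ (Fin p) → ℝ)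
    (xs : Fin n → EuclideanSpace ℝ (Fin p)) (σ : ℝ)
    (v : EuclideanSpace ℝ (Fin p)) : ℝ :=
  σ * Real.sqrt (1 - ∑ j, ∑ k, Ψ (v - xs j) * (kmat Ψ xs)⁻¹ j k * Ψ (v - xs k))

noncomputable def krigRatio {p n : ℕ} (Ψ : EuclideanSpace ℝ (Fin p) → ℝ)
    (xs : Fin n → EuclideanSpace ℝ (Fin p)) (σ : ℝ)
    (f : EuclideanSpace ℝ (Fin p) → ℝ) (v : EuclideanSpace ℝ (Fin p)) : ℝ :=
  (f v - kinterp Ψ xs f v) /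
    (krigSd Ψ xs σ v * Real.sqrt (Real.log (Real.exp 1 * σ / krigSd Ψ xs σ v)))

def GaussCov {p : ℕ} {Ω' : Type*} [MeasurableSpace Ω'] (P : Measure Ω')
    (Z : EuclideanSpace ℝ (Fin p) → Ω' → ℝ) (σ : ℝ)
    (Ψ : EuclideanSpace ℝ (Fin p) → ℝ) : Prop :=
  ∀ (m : ℕ) (c : Fin m → ℝ) (y : Fin m → EuclideanSpace ℝ (Fin p)),
    Measure.map (fun ω' => ∑ i, c i * Z (y i) ω') P =
      gaussianReal 0 (∑ i, ∑ j, c i * c j * (σ ^ 2 * Ψ (y i - y j))).toNNReal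

def IsSpectralDensity {p : ℕ} (Ψ Ψt : EuclideanSpace ℝ (Fin p) → ℝ) : Prop :=
  (∀ ω, 0 ≤ Ψt ω) ∧ Integrable Ψt ∧ ((∫ ω, Ψt ω) = 1) ∧
    ∀ v, Ψ v = ∫ ω, Real.cos ⟪ω, v⟫ * Ψt ω

noncomputable def A0 {p : ℕ} (Ψt : EuclideanSpace ℝ (Fin p) → ℝ) : ℝ :=
  ∫ ω, (∑ i, |ω i|) * Ψt ω

/-- Maximal inequality for a countable Gaussian family. -/
lemma gauss_max {Ω' ι : Type*} [MeasurableSpace Ω'] (P : Measure Ω') [IsProbabilityMeasure P]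
    [Countable ι] (g : ι → Ω' → ℝ) (v : ι → NNReal) (s b : ι → ℝ)
    (hg : ∀ i, P.map (g i) = gaussianReal 0 (v i))
    (hs : ∀ i, 0 < s i) (hv : ∀ i, (v i : ℝ) ≤ s i ^ 2) (hb : ∀ i, 1 ≤ b i)
    (hsum : ∑' i, ENNReal.ofReal (Real.exp (-b i)) ≤ 1) :
    ∃ V : Ω' → ℝ, Integrable V P ∧ (∀ ω, 0 ≤ V ω) ∧ ∫ ω, V ω ∂P ≤ 4 ∧
      ∀ᵐ ω ∂P, ∀ i, |g i ω| ≤ s i * Real.sqrt (b i) * V ω := by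
  have hgm : ∀ i, AEMeasurable (g i) P := fun i => by
    have : NeZero (P.map (g i)) := by rw [hg i]; infer_instance
    exact aemeasurable_of_map_neZero this
  set t : ι → ℝ := fun i => Real.sqrt (b i) / s i with ht
  have key : ∀ i, ∀ τ : ℝ, τ ^ 2 = t i ^ 2 →
      ∫⁻ ω, ENNReal.ofReal (Real.exp (τ * g i ω)) ∂P ≤ ENNReal.ofReal (Real.exp (b i)) := by
    intro i τ hτ
    have h1 : ∫⁻ ω, ENNReal.ofReal (Real.exp (τ * g i ω)) ∂P
        = ∫⁻ x, ENNReal.ofReal (Real.exp (τ * x)) ∂(P.map (g i)) := by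
      rw [lintegral_map' (by fun_prop) (hgm i)]
    rw [h1, hg i, ← ofReal_integral_eq_lintegral_ofReal (integrable_exp_mul_gaussianReal τ)
      (ae_of_all _ fun x => (Real.exp_pos _).le)]
    apply ENNReal.ofReal_le_ofReal
    have h2 := congrFun (mgf_id_gaussianReal (μ := 0) (v := v i)) τ
    simp only [mgf, id] at h2
    rw [h2]
    apply Real.exp_le_exp.2
    have : (v i : ℝ) * τ ^ 2 ≤ b i := by
      rw [hτ, ht]
      simp only [div_pow]
      rw [Real.sq_sqrt (by linarith [hb i]), mul_div_assoc', div_le_iff₀ (by have := hs i; positivity)]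
      nlinarith [hv i, hb i]
    nlinarith [hb i]
  set F : ι → Ω' → ENNReal := fun i ω => ENNReal.ofReal (Real.exp (-(2 * b i))) *
    (ENNReal.ofReal (Real.exp (t i * g i ω)) + ENNReal.ofReal (Real.exp (-t i * g i ω))) with hF
  have hFm : ∀ i, AEMeasurable (F i) P := fun i => by
    have := hgm i
    simp only [hF]; fun_prop
  have hFi : ∀ i, ∫⁻ ω, F i ω ∂P ≤ 2 * ENNReal.ofReal (Real.exp (-b i)) := by
    intro i
    have hm1 : AEMeasurable (fun ω => ENNReal.ofReal (Real.exp (t i * g i ω))) P := by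
      have := hgm i; fun_prop
    simp only [hF]
    rw [lintegral_const_mul' _ _ ENNReal.ofReal_ne_top, lintegral_add_left' hm1]
    calc _ ≤ ENNReal.ofReal (Real.exp (-(2 * b i))) *
          (ENNReal.ofReal (Real.exp (b i)) + ENNReal.ofReal (Real.exp (b i))) := by
          gcongr
          · exact key i _ rfl
          · exact key i _ (by ring)
      _ = 2 * ENNReal.ofReal (Real.exp (-b i)) := by
          rw [← two_mul, mul_left_comm, ← ENNReal.ofReal_mul (Real.exp_pos _).le, ← Real.exp_add]
          congr 3; ring
  have hW : ∫⁻ ω, ∑' i, F i ω ∂P ≤ 2 := by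
    rw [lintegral_tsum hFm]
    calc _ ≤ ∑' i, 2 * ENNReal.ofReal (Real.exp (-b i)) := ENNReal.tsum_le_tsum hFi
      _ = 2 * ∑' i, ENNReal.ofReal (Real.exp (-b i)) := ENNReal.tsum_mul_left
      _ ≤ 2 * 1 := by gcongr
      _ = 2 := by simp
  have hWm : AEMeasurable (fun ω => ∑' i, F i ω) P := AEMeasurable.tsum hFm
  have hWf : ∫⁻ ω, ∑' i, F i ω ∂P ≠ ⊤ := ne_top_of_le_ne_top (by simp) hW
  have hIntg := integrable_toReal_of_lintegral_ne_top hWm hWf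
  refine ⟨fun ω => 2 + (∑' i, F i ω).toReal, (integrable_const _).add hIntg,
    fun ω => by positivity, ?_, ?_⟩
  · rw [integral_add (integrable_const _) hIntg, integral_toReal hWm (ae_lt_top' hWm hWf)]
    have := ENNReal.toReal_mono (by simp) hW
    simp at this ⊢
    linarith
  · filter_upwards [ae_lt_top' hWm hWf] with ω hω i
    have h1 : F i ω ≤ ∑' i, F i ω := ENNReal.le_tsum i
    have h2 := ENNReal.toReal_mono hω.ne h1
    have h3 : (F i ω).toReal = Real.exp (-(2 * b i)) *
        (Real.exp (t i * g i ω) + Real.exp (-t i * g i ω)) := by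
      simp only [hF]
      rw [ENNReal.toReal_mul, ENNReal.toReal_add ENNReal.ofReal_ne_top ENNReal.ofReal_ne_top]
      simp [Real.exp_nonneg]
    rw [h3] at h2
    set W := (∑' i, F i ω).toReal
    have hti : 0 < t i := by
      simp only [ht]; have := hs i; have := hb i
      exact div_pos (Real.sqrt_pos.2 (by linarith)) (hs i)
    have h4 : t i * |g i ω| - 2 * b i + 1 ≤ W := by
      refine le_trans (Real.add_one_le_exp _) (le_trans ?_ h2)
      rw [sub_eq_add_neg, add_comm, Real.exp_add]
      gcongr
      rcases abs_cases (g i ω) with ⟨h, _⟩ | ⟨h, _⟩ <;> rw [h]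
      · linarith [Real.exp_pos (-t i * g i ω)]
      · have : t i * -g i ω = -t i * g i ω := by ring
        rw [this]; linarith [Real.exp_pos (t i * g i ω)]
    have hW0 : 0 ≤ W := ENNReal.toReal_nonneg
    have hsq : Real.sqrt (b i) * Real.sqrt (b i) = b i := Real.mul_self_sqrt (by linarith [hb i])
    have hsp : 0 < Real.sqrt (b i) := Real.sqrt_pos.2 (by linarith [hb i])
    have h5 : t i * |g i ω| ≤ b i * (2 + W) := by nlinarith [hb i]
    have h6 : |g i ω| = t i * |g i ω| * (s i / Real.sqrt (b i)) := by
      simp only [ht]; have := (hs i).ne'; field_simp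
    rw [h6]
    calc _ ≤ b i * (2 + W) * (s i / Real.sqrt (b i)) := by
          have := hs i; gcongr
      _ = Real.sqrt (b i) * Real.sqrt (b i) * (2 + W) * (s i / Real.sqrt (b i)) := by rw [hsq]
      _ = s i * Real.sqrt (b i) * (2 + W) := by field_simp

lemma law_of_span {p : ℕ} {Ω' H : Type*} [MeasurableSpace Ω'] (P : Measure Ω')
    [NormedAddCommGroup H] [InnerProductSpace ℝ H]
    (Z : EuclideanSpace ℝ (Fin p) → Ω' → ℝ) (σ : ℝ) (Ψ : EuclideanSpace ℝ (Fin p) → ℝ)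
    (ζ : EuclideanSpace ℝ (Fin p) → H) (hζ : ∀ x y, inner ℝ (ζ x) (ζ y) = σ ^ 2 * Ψ (x - y))
    (hG : GaussCov P Z σ Ψ) (q : (Ω' → ℝ) × H)
    (hq : q ∈ Submodule.span ℝ (Set.range fun x => (Z x, ζ x))) :
    P.map q.1 = gaussianReal 0 (‖q.2‖ ^ 2).toNNReal := by
  rw [Submodule.mem_span_set'] at hq
  obtain ⟨m, c, y, rfl⟩ := hq
  choose y' hy' using fun i => (y i).2
  simp only [← hy']
  have := hG m c y'
  have e1 : (∑ i, c i • (Z (y' i), ζ (y' i))).1 = fun ω' => ∑ i, c i * Z (y' i) ω' := by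
    ext ω'
    simp [Prod.fst_sum]
  have e2 : ‖(∑ i, c i • (Z (y' i), ζ (y' i))).2‖ ^ 2
      = ∑ i, ∑ j, c i * c j * (σ ^ 2 * Ψ (y' i - y' j)) := by
    rw [Prod.snd_sum, ← real_inner_self_eq_norm_sq, sum_inner]
    refine Finset.sum_congr rfl fun i _ => ?_
    rw [inner_sum]
    refine Finset.sum_congr rfl fun j _ => ?_
    simp only [Prod.smul_mk, real_inner_smul_left, real_inner_smul_right, hζ]
    ring
  rw [e1, e2, this]

lemma spec_facts {p : ℕ} (Ψ Ψt : EuclideanSpace ℝ (Fin p) → ℝ) (h : IsSpectralDensity Ψ Ψt) :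
    Ψ 0 = 1 ∧ (∀ v, Ψ (-v) = Ψ v) ∧ (∀ v, -1 ≤ Ψ v) ∧ (∀ v, Integrable fun ω => Real.cos ⟪ω, v⟫ * Ψt ω) := by
  obtain ⟨h0, hi, h1, hΨ⟩ := h
  have hIntg : ∀ v, Integrable fun ω => Real.cos ⟪ω, v⟫ * Ψt ω := fun v => by
    refine hi.bdd_mul (c := 1) ?_ ?_
    · exact (by fun_prop : Continuous fun ω : EuclideanSpace ℝ (Fin p) => Real.cos ⟪ω, v⟫).aestronglyMeasurable
    · exact ae_of_all _ fun ω => by simpa using Real.abs_cos_le_one _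
  refine ⟨by simp [hΨ, h1], fun v => by simp [hΨ], fun v => ?_, hIntg⟩
  rw [hΨ, ← h1, ← integral_neg]
  refine integral_mono hi.neg (hIntg v) fun ω => ?_
  have := Real.neg_one_le_cos ⟪ω, v⟫
  nlinarith [h0 ω]

lemma one_sub_le {p : ℕ} (Ψ Ψt : EuclideanSpace ℝ (Fin p) → ℝ) (h : IsSpectralDensity Ψ Ψt)
    (hA : Integrable (fun ω => (∑ i, |ω i|) * Ψt ω)) (v : EuclideanSpace ℝ (Fin p)) (δ : ℝ)
    (hv : ∀ i, |v i| ≤ δ) : 1 - Ψ v ≤ A0 Ψt * δ := by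
  obtain ⟨-, -, -, hIntg⟩ := spec_facts Ψ Ψt h
  obtain ⟨h0, hi, h1, hΨ⟩ := h
  rw [hΨ, ← h1, ← integral_sub hi (hIntg v), A0, ← integral_mul_const]
  refine integral_mono (hi.sub (hIntg v)) (hA.mul_const δ) fun ω => ?_
  have hin : |⟪ω, v⟫| ≤ (∑ i, |ω i|) * δ := by
    rw [PiLp.inner_apply, Finset.sum_mul]
    refine (Finset.abs_sum_le_sum_abs _ _).trans (Finset.sum_le_sum fun i _ => ?_)
    simp only [RCLike.inner_apply, conj_trivial, abs_mul]
    rw [mul_comm]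
    exact mul_le_mul_of_nonneg_left (hv i) (abs_nonneg _)
  have hc : 1 - Real.cos ⟪ω, v⟫ ≤ |⟪ω, v⟫| := by
    have a := Real.one_sub_sq_div_two_le_cos (x := ⟪ω, v⟫)
    have b := Real.neg_one_le_cos ⟪ω, v⟫
    by_cases hx : |⟪ω, v⟫| ≤ 2
    · nlinarith [sq_abs ⟪ω, v⟫, abs_nonneg ⟪ω, v⟫]
    · linarith
  have := h0 ω
  calc Ψt ω - Real.cos ⟪ω, v⟫ * Ψt ω = (1 - Real.cos ⟪ω, v⟫) * Ψt ω := by ring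
    _ ≤ ((∑ i, |ω i|) * δ) * Ψt ω := by gcongr; linarith
    _ = _ := by ring

lemma psi_cont {p : ℕ} (Ψ Ψt : EuclideanSpace ℝ (Fin p) → ℝ) (h : IsSpectralDensity Ψ Ψt) :
    Continuous Ψ := by
  obtain ⟨-, -, -, hIntg⟩ := spec_facts Ψ Ψt h
  obtain ⟨h0, hi, h1, hΨ⟩ := h
  have : Ψ = fun v => ∫ ω, Real.cos ⟪ω, v⟫ * Ψt ω := funext hΨ
  rw [this]
  refine continuous_of_dominated (bound := fun ω => Ψt ω) (fun v => (hIntg v).1) (fun v => ?_) hi ?_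
  · refine ae_of_all _ fun ω => ?_
    rw [norm_mul, Real.norm_eq_abs, Real.norm_eq_abs, abs_of_nonneg (h0 ω)]
    nlinarith [Real.abs_cos_le_one ⟪ω, v⟫, h0 ω]
  · exact ae_of_all _ fun ω => by fun_prop

/-- The Gaussian Hilbert space feature map. -/
lemma feature {p : ℕ} {Ω' : Type} [MeasurableSpace Ω'] (P : Measure Ω') [IsProbabilityMeasure P]
    (Ψ Ψt : EuclideanSpace ℝ (Fin p) → ℝ) (h : IsSpectralDensity Ψ Ψt)
    (Z : EuclideanSpace ℝ (Fin p) → Ω' → ℝ) (σ : ℝ)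
    (hG : GaussCov P Z σ Ψ) :
    ∃ ζ : EuclideanSpace ℝ (Fin p) → Lp ℝ 2 P, ∀ x y, inner ℝ (ζ x) (ζ y) = σ ^ 2 * Ψ (x - y) := by
  obtain ⟨hp0, hpe, hpn, -⟩ := spec_facts Ψ Ψt h
  have hsecond : ∀ (g : Ω' → ℝ) (v : NNReal), P.map g = gaussianReal 0 v →
      MemLp g 2 P ∧ ∫ ω, g ω * g ω ∂P = v := by
    intro g v hg
    have hgm : AEMeasurable g P := by
      have : NeZero (P.map g) := by rw [hg]; infer_instance
      exact aemeasurable_of_map_neZero this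
    have hid : MemLp (id : ℝ → ℝ) 2 (P.map g) := by
      rw [hg]; exact memLp_id_gaussianReal 2
    refine ⟨(memLp_map_measure_iff hid.1 hgm).1 hid, ?_⟩
    have h1 : ∫ ω, g ω * g ω ∂P = ∫ x, x * x ∂(P.map g) := by
      rw [integral_map hgm (by fun_prop)]
    have h2 := variance_id_gaussianReal (μ := 0) (v := v)
    rw [variance_eq_integral (by fun_prop)] at h2
    simp only [id, integral_id_gaussianReal, sub_zero] at h2
    rw [h1, hg, ← h2]
    simp [sq]
  have hone : ∀ x, P.map (Z x) = gaussianReal 0 (σ ^ 2).toNNReal := by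
    intro x
    have := hG 1 (fun _ => 1) (fun _ => x)
    simpa [hp0] using this
  have htwo : ∀ x y, P.map (fun ω => Z x ω + Z y ω)
      = gaussianReal 0 (σ ^ 2 * (2 + 2 * Ψ (x - y))).toNNReal := by
    intro x y
    have := hG 2 (fun _ => 1) ![x, y]
    simp only [Fin.sum_univ_two, Matrix.cons_val_zero, Matrix.cons_val_one, sub_self, hp0,
      one_mul, mul_one] at this
    rw [this]
    congr 2
    rw [← neg_sub x y, hpe]; ring
  have hL : ∀ x, MemLp (Z x) 2 P := fun x => (hsecond _ _ (hone x)).1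
  refine ⟨fun x => (hL x).toLp, fun x y => ?_⟩
  rw [L2.inner_def]
  have e : ∫ ω, inner ℝ ((hL x).toLp (Z x) ω) ((hL y).toLp (Z y) ω) ∂P = ∫ ω, Z x ω * Z y ω ∂P := by
    refine integral_congr_ae ?_
    filter_upwards [(hL x).coeFn_toLp, (hL y).coeFn_toLp] with ω h1 h2
    rw [h1, h2]; simp [mul_comm]
  rw [e]
  have i1 : Integrable (fun ω => Z x ω * Z y ω) P := (hL x).integrable_mul (hL y)
  have i2 : Integrable (fun ω => Z x ω * Z x ω) P := (hL x).integrable_mul (hL x)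
  have i3 : Integrable (fun ω => Z y ω * Z y ω) P := (hL y).integrable_mul (hL y)
  have a1 := (hsecond _ _ (hone x)).2
  have a2 := (hsecond _ _ (hone y)).2
  have a3 := (hsecond _ _ (htwo x y)).2
  rw [Real.coe_toNNReal _ (by positivity)] at a1 a2
  rw [Real.coe_toNNReal _ (by have := hpn (x - y); have : 0 ≤ 2 + 2 * Ψ (x - y) := by linarith
                              positivity)] at a3
  have e3 : ∫ ω, (Z x ω + Z y ω) * (Z x ω + Z y ω) ∂P
      = ∫ ω, Z x ω * Z x ω ∂P + 2 * ∫ ω, Z x ω * Z y ω ∂P + ∫ ω, Z y ω * Z y ω ∂P := by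
    have i4 : Integrable (fun ω => Z x ω * Z x ω + 2 * (Z x ω * Z y ω)) P := i2.add (i1.const_mul 2)
    rw [← integral_const_mul, ← integral_add i2 (i1.const_mul 2), ← integral_add i4 i3]
    refine integral_congr_ae (ae_of_all _ fun ω => ?_)
    dsimp only
    ring
  rw [e3, a1, a2] at a3
  linarith

noncomputable def kres {p n : ℕ} {H : Type*} [AddCommGroup H] [Module ℝ H]
    (Ψ : EuclideanSpace ℝ (Fin p) → ℝ)
    (xs : Fin n → EuclideanSpace ℝ (Fin p)) (ζ : EuclideanSpace ℝ (Fin p) → H)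
    (v : EuclideanSpace ℝ (Fin p)) : H :=
  ζ v - ∑ j, ∑ k, (Ψ (v - xs j) * (kmat Ψ xs)⁻¹ j k) • ζ (xs k)

section krig

variable {p n : ℕ} {H : Type*} [NormedAddCommGroup H] [InnerProductSpace ℝ H]

lemma kres_orth (Ψ : EuclideanSpace ℝ (Fin p) → ℝ) (hpe : ∀ v, Ψ (-v) = Ψ v)
    (xs : Fin n → EuclideanSpace ℝ (Fin p)) (ζ : EuclideanSpace ℝ (Fin p) → H) (σ : ℝ)
    (hζ : ∀ x y, inner ℝ (ζ x) (ζ y) = σ ^ 2 * Ψ (x - y)) (hK : IsUnit (kmat Ψ xs).det)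
    (v : EuclideanSpace ℝ (Fin p)) (l : Fin n) : inner ℝ (kres Ψ xs ζ v) (ζ (xs l)) = 0 := by
  rw [kres, inner_sub_left, sum_inner, hζ]
  have : ∀ j, inner ℝ (∑ k, (Ψ (v - xs j) * (kmat Ψ xs)⁻¹ j k) • ζ (xs k)) (ζ (xs l))
      = σ ^ 2 * Ψ (v - xs j) * ((kmat Ψ xs)⁻¹ * kmat Ψ xs) j l := by
    intro j
    rw [sum_inner, Matrix.mul_apply, Finset.mul_sum]
    refine Finset.sum_congr rfl fun k _ => ?_
    rw [real_inner_smul_left, hζ, kmat, Matrix.of_apply]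
    ring
  simp_rw [this, Matrix.nonsing_inv_mul _ hK, Matrix.one_apply]
  simp

lemma kres_contr (Ψ : EuclideanSpace ℝ (Fin p) → ℝ) (hpe : ∀ v, Ψ (-v) = Ψ v)
    (xs : Fin n → EuclideanSpace ℝ (Fin p)) (ζ : EuclideanSpace ℝ (Fin p) → H) (σ : ℝ)
    (hζ : ∀ x y, inner ℝ (ζ x) (ζ y) = σ ^ 2 * Ψ (x - y)) (hK : IsUnit (kmat Ψ xs).det)
    (x y : EuclideanSpace ℝ (Fin p)) : ‖kres Ψ xs ζ x - kres Ψ xs ζ y‖ ≤ ‖ζ x - ζ y‖ := by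
  have ho := kres_orth Ψ hpe xs ζ σ hζ hK
  set a := kres Ψ xs ζ x - kres Ψ xs ζ y with ha
  have hab : inner ℝ a (ζ x - ζ y - a) = 0 := by
    have : ζ x - ζ y - a = ∑ j, ∑ k, (Ψ (x - xs j) * (kmat Ψ xs)⁻¹ j k) • ζ (xs k)
      - ∑ j, ∑ k, (Ψ (y - xs j) * (kmat Ψ xs)⁻¹ j k) • ζ (xs k) := by
      rw [ha, kres, kres]; abel
    rw [this]
    simp only [inner_sub_right, inner_sum, real_inner_smul_right, ha, inner_sub_left, ho]
    simp
  have h2 : ‖ζ x - ζ y‖ ^ 2 = ‖a‖ ^ 2 + ‖ζ x - ζ y - a‖ ^ 2 := by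
    have := norm_add_sq_real a (ζ x - ζ y - a)
    rw [hab, add_sub_cancel] at this
    linarith
  nlinarith [norm_nonneg a, norm_nonneg (ζ x - ζ y), sq_nonneg ‖ζ x - ζ y - a‖]

lemma kres_norm (Ψ : EuclideanSpace ℝ (Fin p) → ℝ) (hp0 : Ψ 0 = 1) (hpe : ∀ v, Ψ (-v) = Ψ v)
    (xs : Fin n → EuclideanSpace ℝ (Fin p)) (ζ : EuclideanSpace ℝ (Fin p) → H) (σ : ℝ) (hσ : 0 < σ)
    (hζ : ∀ x y, inner ℝ (ζ x) (ζ y) = σ ^ 2 * Ψ (x - y)) (hK : IsUnit (kmat Ψ xs).det)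
    (x : EuclideanSpace ℝ (Fin p)) : krigSd Ψ xs σ x = ‖kres Ψ xs ζ x‖ ∧ ‖kres Ψ xs ζ x‖ ≤ σ := by
  have ho := kres_orth Ψ hpe xs ζ σ hζ hK
  have h1 : ‖kres Ψ xs ζ x‖ ^ 2 = inner ℝ (kres Ψ xs ζ x) (ζ x) := by
    rw [← real_inner_self_eq_norm_sq]
    nth_rewrite 2 [kres]
    simp only [inner_sub_right, inner_sum, real_inner_smul_right, ho]
    simp
  have h2 : ‖kres Ψ xs ζ x‖ ^ 2
      = σ ^ 2 * (1 - ∑ j, ∑ k, Ψ (x - xs j) * (kmat Ψ xs)⁻¹ j k * Ψ (x - xs k)) := by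
    rw [h1, kres, inner_sub_left, hζ, sub_self, hp0, mul_sub, Finset.mul_sum, sum_inner]
    congr 1
    refine Finset.sum_congr rfl fun j _ => ?_
    rw [sum_inner, Finset.mul_sum]
    refine Finset.sum_congr rfl fun k _ => ?_
    rw [real_inner_smul_left, hζ, ← neg_sub x, hpe]
    ring
  constructor
  · rw [krigSd]
    have : σ = Real.sqrt (σ ^ 2) := (Real.sqrt_sq hσ.le).symm
    nth_rewrite 1 [this]
    rw [← Real.sqrt_mul (by positivity), ← h2, Real.sqrt_sq (norm_nonneg _)]
  · have h3 : ‖ζ x‖ = σ := by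
      have : ‖ζ x‖ ^ 2 = σ ^ 2 := by rw [← real_inner_self_eq_norm_sq, hζ, sub_self, hp0, mul_one]
      exact (pow_left_inj₀ (norm_nonneg _) hσ.le two_ne_zero).1 this
    have h4 := real_inner_le_norm (kres Ψ xs ζ x) (ζ x)
    rw [← h1, h3] at h4
    by_contra hcon
    push Not at hcon
    nlinarith [norm_nonneg (kres Ψ xs ζ x)]

lemma kres_span {Ω' : Type*} (Ψ : EuclideanSpace ℝ (Fin p) → ℝ)
    (xs : Fin n → EuclideanSpace ℝ (Fin p)) (ζ : EuclideanSpace ℝ (Fin p) → H)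
    (Z : EuclideanSpace ℝ (Fin p) → Ω' → ℝ) (x : EuclideanSpace ℝ (Fin p)) :
    ((fun ω => Z x ω - kinterp Ψ xs (fun y => Z y ω) x, kres Ψ xs ζ x) : (Ω' → ℝ) × H) ∈
      Submodule.span ℝ (Set.range fun x => (Z x, ζ x)) := by
  have hm : ∀ x, (Z x, ζ x) ∈ Submodule.span ℝ (Set.range fun x => (Z x, ζ x)) :=
    fun x => Submodule.subset_span ⟨x, rfl⟩
  have e : ((fun ω => Z x ω - kinterp Ψ xs (fun y => Z y ω) x, kres Ψ xs ζ x) : (Ω' → ℝ) × H)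
      = (Z x, ζ x) - ∑ j, ∑ k, (Ψ (x - xs j) * (kmat Ψ xs)⁻¹ j k) • (Z (xs k), ζ (xs k)) := by
    ext1
    · ext ω
      simp [kinterp, Prod.fst_sum]
    · simp [kres, Prod.snd_sum]
  rw [e]
  exact Submodule.sub_mem _ (hm x) (Submodule.sum_mem _ fun j _ => Submodule.sum_mem _ fun k _ =>
    Submodule.smul_mem _ _ (hm _))

end krig

lemma grid {p : ℕ} (Ω : Set (EuclideanSpace ℝ (Fin p))) (hΩ : Bornology.IsBounded Ω)
    (hne : Ω.Nonempty) (hD : 0 < Metric.diam Ω) (N : ℕ) (hN : 0 < N) :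
    ∃ T : Finset (EuclideanSpace ℝ (Fin p)), T.card ≤ (2 * N + 1) ^ p ∧
      ∀ x ∈ Ω, ∃ u ∈ T, ∀ i, |(x - u) i| ≤ Metric.diam Ω / N := by
  classical
  obtain ⟨x0, hx0⟩ := hne
  set D := Metric.diam Ω
  have hN' : (0:ℝ) < N := by exact_mod_cast hN
  refine ⟨(Fintype.piFinset fun _ : Fin p => Finset.Icc (-N : ℤ) N).image
    fun m => WithLp.toLp 2 fun i => x0 i + D / N * m i, ?_, ?_⟩
  · refine Finset.card_image_le.trans ?_
    rw [Fintype.card_piFinset]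
    simp only [Int.card_Icc, Finset.prod_const, Finset.card_univ, Fintype.card_fin]
    apply le_of_eq; congr 1; omega
  · intro x hx
    set m : Fin p → ℤ := fun i => ⌊(x i - x0 i) / (D / N)⌋ with hm
    have hq : 0 < D / N := by positivity
    refine ⟨_, Finset.mem_image_of_mem _ (a := m) ?_, ?_⟩
    · rw [Fintype.mem_piFinset]
      intro i
      have h1 : |x i - x0 i| ≤ D := by
        have := PiLp.norm_apply_le (x - x0) i
        rw [← dist_eq_norm] at this
        exact this.trans (Metric.dist_le_diam_of_mem hΩ hx hx0)
      rw [abs_le] at h1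
      rw [Finset.mem_Icc]
      constructor
      · rw [Int.le_floor, le_div_iff₀ hq]
        push_cast
        have : -(N:ℝ) * (D / N) = - D := by field_simp
        linarith
      · have : m i < N + 1 := by
          rw [Int.floor_lt, div_lt_iff₀ hq]
          push_cast
          have : ((N:ℝ) + 1) * (D / N) = D + D / N := by field_simp
          linarith
        omega
    · intro i
      have h1 := Int.floor_le ((x i - x0 i) / (D / N))
      have h2 := Int.lt_floor_add_one ((x i - x0 i) / (D / N))
      rw [le_div_iff₀ hq] at h1
      rw [div_lt_iff₀ hq] at h2
      simp only [PiLp.sub_apply, hm]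
      rw [abs_le]
      constructor <;> nlinarith

lemma nets {p : ℕ} {H : Type*} [NormedAddCommGroup H] [InnerProductSpace ℝ H]
    (Ω : Set (EuclideanSpace ℝ (Fin p))) (hΩ : Bornology.IsBounded Ω)
    (hne : Ω.Nonempty) (hD : 0 < Metric.diam Ω)
    (Ψ Ψt : EuclideanSpace ℝ (Fin p) → ℝ) (h : IsSpectralDensity Ψ Ψt)
    (hA : Integrable (fun ω => (∑ i, |ω i|) * Ψt ω))
    (ζ : EuclideanSpace ℝ (Fin p) → H) (σ : ℝ) (hσ : 0 < σ)
    (hζ : ∀ x y, inner ℝ (ζ x) (ζ y) = σ ^ 2 * Ψ (x - y)) (L : ℝ)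
    (hL : L = max 1 (Real.log (A0 Ψt * Metric.diam Ω))) (j : ℕ) :
    ∃ T : Finset (EuclideanSpace ℝ (Fin p)), (T.card : ℝ) ≤ Real.exp (4 * p * (L + j)) ∧
      ∀ x ∈ Ω, ∃ u ∈ T, ‖ζ x - ζ u‖ ≤ σ * (1 / 2) ^ j := by
  obtain ⟨hp0, hpe, -, -⟩ := spec_facts Ψ Ψt h
  have hL1 : 1 ≤ L := hL ▸ le_max_left _ _
  set D := Metric.diam Ω with hDdef
  have hA0 : 0 ≤ A0 Ψt := integral_nonneg fun ω =>
    mul_nonneg (Finset.sum_nonneg fun i _ => abs_nonneg _) (h.1 ω)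
  have hR : A0 Ψt * D ≤ Real.exp L := by
    rcases hA0.eq_or_lt with h0 | h0
    · rw [← h0, zero_mul]; positivity
    · rw [← Real.log_le_iff_le_exp (by positivity), hL]; exact le_max_right _ _
  set R := Real.exp L with hRdef
  have hR1 : 1 ≤ R := Real.one_le_exp (by linarith)
  set N := ⌈2 * R * 4 ^ j⌉₊ with hN
  have h4 : (1:ℝ) ≤ 4 ^ j := one_le_pow₀ (by norm_num)
  have hNge : 2 * R * 4 ^ j ≤ N := Nat.le_ceil _
  have hNle : (N:ℝ) ≤ 2 * R * 4 ^ j + 1 := (Nat.ceil_lt_add_one (by positivity)).le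
  have hRj : 1 ≤ R * 4 ^ j := one_le_mul_of_one_le_of_one_le hR1 h4
  have hNpos : 0 < N := by
    have : (0:ℝ) < N := by linarith
    exact_mod_cast this
  have hNpos' : (0:ℝ) < N := by exact_mod_cast hNpos
  obtain ⟨T, hT, hcov⟩ := grid Ω hΩ hne hD N hNpos
  refine ⟨T, ?_, fun x hx => ?_⟩
  · have h1 : (2 * (N:ℝ) + 1) ≤ Real.exp (4 * (L + j)) := by
      have e8 : (8:ℝ) ≤ Real.exp 3 := by
        have : (2:ℝ) ≤ Real.exp 1 := by linarith [Real.add_one_le_exp (1:ℝ)]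
        calc (8:ℝ) = 2 ^ 3 := by norm_num
          _ ≤ Real.exp 1 ^ 3 := by gcongr
          _ = Real.exp 3 := by rw [← Real.exp_nat_mul]; norm_num
      have e4 : (4:ℝ) ^ j ≤ Real.exp (2 * j) := by
        have : (4:ℝ) ≤ Real.exp 2 := by
          have : (2:ℝ) ≤ Real.exp 1 := by linarith [Real.add_one_le_exp (1:ℝ)]
          calc (4:ℝ) = 2 ^ 2 := by norm_num
            _ ≤ Real.exp 1 ^ 2 := by gcongr
            _ = Real.exp 2 := by rw [← Real.exp_nat_mul]; norm_num
        calc (4:ℝ) ^ j ≤ Real.exp 2 ^ j := by gcongr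
          _ = _ := by rw [← Real.exp_nat_mul]; ring_nf
      calc (2 * (N:ℝ) + 1) ≤ 8 * (R * 4 ^ j) := by linarith
        _ ≤ Real.exp 3 * (Real.exp L * Real.exp (2 * j)) := by gcongr
        _ = Real.exp (3 + (L + 2 * j)) := by rw [Real.exp_add, Real.exp_add]
        _ ≤ _ := by
          apply Real.exp_le_exp.2
          have : (0:ℝ) ≤ j := by positivity
          linarith
    calc (T.card : ℝ) ≤ (2 * N + 1) ^ p := by exact_mod_cast hT
      _ ≤ Real.exp (4 * (L + j)) ^ p := by gcongr
      _ = _ := by rw [← Real.exp_nat_mul]; ring_nf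
  · obtain ⟨u, hu, hxu⟩ := hcov x hx
    refine ⟨u, hu, ?_⟩
    have h1 := one_sub_le Ψ Ψt h hA (x - u) _ hxu
    have h2 : ‖ζ x - ζ u‖ ^ 2 = 2 * σ ^ 2 * (1 - Ψ (x - u)) := by
      rw [norm_sub_sq_real, ← real_inner_self_eq_norm_sq, ← real_inner_self_eq_norm_sq, hζ, hζ, hζ]
      simp only [sub_self, hp0]; ring
    have h3 : A0 Ψt * (D / N) ≤ 1 / (2 * 4 ^ j) := by
      rw [← mul_div_assoc, div_le_div_iff₀ hNpos' (by positivity)]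
      nlinarith
    have h5 : ‖ζ x - ζ u‖ ^ 2 ≤ (σ * (1 / 2) ^ j) ^ 2 := by
      rw [h2]
      calc _ ≤ 2 * σ ^ 2 * (1 / (2 * 4 ^ j)) := by
            have := h1.trans h3
            gcongr
        _ = _ := by
            rw [mul_pow, ← pow_mul, mul_comm j 2, pow_mul]; norm_num
            field_simp
            rw [← mul_pow]; norm_num
    exact (pow_le_pow_iff_left₀ (norm_nonneg _) (by positivity) two_ne_zero).1 h5

lemma tsum_exp_le : ∑' j : ℕ, ENNReal.ofReal (Real.exp (-((j : ℝ) + 1))) ≤ 1 := by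
  have h2 : Real.exp (-1) ≤ 1 / 2 := by
    rw [Real.exp_neg, one_div]
    exact inv_anti₀ (by norm_num) (by linarith [Real.add_one_le_exp (1:ℝ)])
  calc _ ≤ ∑' j : ℕ, ENNReal.ofReal (1 / 2 / 2 ^ j) := by
        refine ENNReal.tsum_le_tsum fun j => ENNReal.ofReal_le_ofReal ?_
        calc Real.exp (-((j : ℝ) + 1)) = Real.exp (-1) ^ (j + 1) := by
              rw [← Real.exp_nat_mul]; push_cast; ring_nf
          _ ≤ (1 / 2) ^ (j + 1) := by gcongr
          _ = _ := by rw [pow_succ, one_div_pow]; ring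
    _ = ENNReal.ofReal (∑' j : ℕ, 1 / 2 / 2 ^ j) :=
        (ENNReal.ofReal_tsum_of_nonneg (fun j => by positivity) (summable_geometric_two' 1)).symm
    _ ≤ 1 := by rw [tsum_geometric_two']; simp

lemma tsum_sigma_le (κ : ℕ → Type*) [∀ j, Fintype (κ j)] (b : ℕ → ℝ)
    (hc : ∀ j, (Fintype.card (κ j) : ℝ) ≤ Real.exp (b j / 2)) (hb : ∀ j : ℕ, (j : ℝ) + 1 ≤ b j / 2) :
    ∑' i : (Σ j, κ j), ENNReal.ofReal (Real.exp (-b i.1)) ≤ 1 := by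
  rw [ENNReal.tsum_sigma']
  refine le_trans (ENNReal.tsum_le_tsum fun j => ?_) tsum_exp_le
  dsimp only
  rw [tsum_fintype, Finset.sum_const, nsmul_eq_mul, Finset.card_univ, ← ENNReal.ofReal_natCast,
    ← ENNReal.ofReal_mul (by positivity)]
  apply ENNReal.ofReal_le_ofReal
  calc _ ≤ Real.exp (b j / 2) * Real.exp (-b j) := by
        have := hc j; gcongr
    _ = Real.exp (-(b j / 2)) := by rw [← Real.exp_add]; ring_nf
    _ ≤ _ := Real.exp_le_exp.2 (by linarith [hb j])

lemma sqrt_lin (q L : ℝ) (k i : ℕ) (hq : 0 ≤ q) (hL : 1 ≤ L) :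
    Real.sqrt (q * (L + (k + i : ℕ))) ≤ Real.sqrt (q * (L + k)) * (1 + i) := by
  have hk : (0:ℝ) ≤ k := by positivity
  have hi : (0:ℝ) ≤ i := by positivity
  apply Real.sqrt_le_iff.2 ⟨by positivity, ?_⟩
  rw [mul_pow, Real.sq_sqrt (by positivity)]
  push_cast
  have : L + (k + i) ≤ (L + k) * (1 + i) ^ 2 := by
    have h1 : 0 ≤ (L + k - 1) * i := mul_nonneg (by linarith) hi
    have h2 : 0 ≤ (L + k) * (i : ℝ) ^ 2 := by positivity
    nlinarith
  calc q * (L + (k + i)) ≤ q * ((L + k) * (1 + i) ^ 2) := by gcongr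
    _ = _ := by ring

lemma chain_sum (a : ℕ → ℝ) (B : ℝ) (k : ℕ)
    (h : ∀ i : ℕ, |a (i + 1) - a i| ≤ B * ((1 / 2) ^ i * (1 + i))) (n : ℕ) :
    |a n - a 0| ≤ B * (4 - (2 * n + 4) * (1 / 2) ^ n) := by
  induction n with
  | zero => simp
  | succ n ih =>
    have h1 := abs_add_le (a (n + 1) - a n) (a n - a 0)
    rw [sub_add_sub_cancel] at h1
    have := h n
    push_cast
    rw [pow_succ]
    nlinarith

lemma chain {X Ω' H : Type*} [MeasurableSpace Ω'] (P : Measure Ω') [IsProbabilityMeasure P]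
    [NormedAddCommGroup H] [InnerProductSpace ℝ H] (S : Set X) (γ : X → H) (G : X → Ω' → ℝ)
    (h1 : ∀ x, P.map (G x) = gaussianReal 0 (‖γ x‖ ^ 2).toNNReal)
    (h2 : ∀ x y, P.map (G x - G y) = gaussianReal 0 (‖γ x - γ y‖ ^ 2).toNNReal)
    (p : ℕ) (hp : 0 < p) (L : ℝ) (hL : 1 ≤ L) (σ : ℝ) (hσ : 0 < σ)
    (T : ℕ → Finset X) (hT : ∀ j, ((T j).card : ℝ) ≤ Real.exp (4 * p * (L + j)))
    (hcov : ∀ j, ∀ x ∈ S, ∃ u ∈ T j, ‖γ x - γ u‖ ≤ σ * (1 / 2) ^ j) :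
    ∃ V : Ω' → ℝ, Integrable V P ∧ (∀ ω, 0 ≤ V ω) ∧ ∫ ω, V ω ∂P ≤ 8 ∧
      ∀ x ∈ S, ∀ᵐ ω ∂P, ∀ k : ℕ, ‖γ x‖ < 2 * σ * (1 / 2) ^ k →
        |G x ω| ≤ 72 * σ * (1 / 2) ^ k * Real.sqrt (p * (L + k)) * V ω := by
  have hp1 : (1:ℝ) ≤ p := by exact_mod_cast hp
  set b : ℕ → ℝ := fun j => 8 * p * (2 * L + 2 * j + 1) with hb
  have hbj : ∀ j : ℕ, (j:ℝ) + 1 ≤ b j / 2 := fun j => by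
    have : (0:ℝ) ≤ j := by positivity
    simp only [hb]; nlinarith
  have hb1 : ∀ j : ℕ, 1 ≤ b j := fun j => by
    have := hbj j
    have : (0:ℝ) ≤ j := by positivity
    linarith
  have hbs : ∀ j : ℕ, Real.sqrt (b j) ≤ 6 * Real.sqrt (p * (L + j)) := fun j => by
    have : (0:ℝ) ≤ j := by positivity
    apply Real.sqrt_le_iff.2 ⟨by positivity, ?_⟩
    rw [mul_pow, Real.sq_sqrt (by positivity)]
    simp only [hb]
    nlinarith
  have hpos : ∀ j : ℕ, 0 < σ * (1 / 2) ^ j := fun j => by positivity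
  obtain ⟨V1, i1, n1, m1, e1⟩ := gauss_max P (ι := Σ j, T j) (fun i => G i.2)
    (fun i => (‖γ i.2‖ ^ 2).toNNReal) (fun i => ‖γ i.2‖ + σ * (1 / 2) ^ i.1) (fun i => b i.1)
    (fun i => h1 _) (fun i => by have := hpos i.1; positivity)
    (fun i => by
      have := hpos i.1
      rw [Real.coe_toNNReal _ (by positivity)]
      gcongr
      linarith)
    (fun i => hb1 _)
    (tsum_sigma_le (fun j => T j) b (fun j => by
      rw [Fintype.card_coe]
      refine (hT j).trans (Real.exp_le_exp.2 ?_)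
      have : (0:ℝ) ≤ j := by positivity
      simp only [hb]; nlinarith) hbj)
  obtain ⟨V2, i2, n2, m2, e2⟩ := gauss_max P (ι := Σ j, (T j × T (j + 1)))
    (fun i => G i.2.2 - G i.2.1)
    (fun i => (‖γ i.2.2 - γ i.2.1‖ ^ 2).toNNReal)
    (fun i => ‖γ i.2.2 - γ i.2.1‖ + σ * (1 / 2) ^ i.1) (fun i => b i.1)
    (fun i => h2 _ _) (fun i => by have := hpos i.1; positivity)
    (fun i => by
      have := hpos i.1
      rw [Real.coe_toNNReal _ (by positivity)]
      gcongr
      linarith)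
    (fun i => hb1 _)
    (tsum_sigma_le (fun j => (T j × T (j + 1))) b (fun j => by
      rw [Fintype.card_prod, Fintype.card_coe, Fintype.card_coe]
      push_cast
      calc _ ≤ Real.exp (4 * p * (L + j)) * Real.exp (4 * p * (L + (j + 1 : ℕ))) := by
            have a := hT j
            have b := hT (j + 1)
            gcongr
        _ = _ := by
            rw [← Real.exp_add]
            simp only [hb]; push_cast; ring_nf) hbj)
  refine ⟨fun ω => V1 ω + V2 ω, i1.add i2, fun ω => add_nonneg (n1 ω) (n2 ω), ?_, ?_⟩
  · rw [integral_add i1 i2]; linarith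
  intro x hx
  choose π hπT hπ using fun j => hcov j x hx
  obtain ⟨V3, -, n3, -, e3⟩ := gauss_max P (ι := ℕ) (fun j => G x - G (π j))
    (fun j => (‖γ x - γ (π j)‖ ^ 2).toNNReal)
    (fun j => σ * (1 / 2) ^ j) (fun j => (j:ℝ) + 1)
    (fun i => h2 _ _) hpos
    (fun j => by
      rw [Real.coe_toNNReal _ (by positivity)]
      have := hπ j
      gcongr)
    (fun i => by simp)
    tsum_exp_le
  filter_upwards [e1, e2, e3] with ω e1 e2 e3 k hk
  set Q := Real.sqrt (p * (L + k)) with hQ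
  have hQ0 : 0 ≤ Q := Real.sqrt_nonneg _
  have hk0 := hpos k
  have start : |G (π k) ω| ≤ 24 * (σ * (1 / 2) ^ k) * Q * V1 ω := by
    have a1 := e1 ⟨k, ⟨π k, hπT k⟩⟩
    dsimp only at a1
    have a2 : ‖γ (π k)‖ ≤ 3 * (σ * (1 / 2) ^ k) := by
      have := norm_sub_norm_le (γ (π k)) (γ x)
      rw [norm_sub_rev] at this
      linarith [hπ k]
    calc _ ≤ _ := a1
      _ ≤ (3 * (σ * (1 / 2) ^ k) + σ * (1 / 2) ^ k) * (6 * Q) * V1 ω := by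
          have := hbs k
          have := n1 ω
          gcongr
      _ = _ := by ring
  have step : ∀ i : ℕ, |G (π (k + (i + 1))) ω - G (π (k + i)) ω|
      ≤ (18 * (σ * (1 / 2) ^ k) * Q * V2 ω) * ((1 / 2) ^ i * (1 + i)) := by
    intro i
    have a1 := e2 ⟨k + i, ⟨π (k + i), hπT _⟩, ⟨π (k + i + 1), hπT _⟩⟩
    simp only [Pi.sub_apply] at a1
    have a2 : ‖γ (π (k + i + 1)) - γ (π (k + i))‖ ≤ 2 * (σ * (1 / 2) ^ (k + i)) := by
      have t := norm_sub_le_norm_sub_add_norm_sub (γ (π (k + i + 1))) (γ x) (γ (π (k + i)))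
      have b1 := hπ (k + i)
      have b2 := hπ (k + i + 1)
      rw [norm_sub_rev] at b2
      have := hpos (k + i)
      rw [pow_succ] at b2
      linarith
    calc _ ≤ _ := a1
      _ ≤ (2 * (σ * (1 / 2) ^ (k + i)) + σ * (1 / 2) ^ (k + i)) * (6 * (Q * (1 + i))) * V2 ω := by
          have b1 := hbs (k + i)
          have b2 := sqrt_lin p L k i (by positivity) hL
          have := n2 ω
          gcongr
          linarith
      _ = _ := by rw [pow_add]; ring
  have all : ∀ n : ℕ, |G x ω| ≤ 72 * σ * (1 / 2) ^ k * Q * (V1 ω + V2 ω)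
      + σ * (1 / 2) ^ (k + n) * Real.sqrt ((k + n : ℕ) + 1) * V3 ω := by
    intro n
    have c1 := chain_sum (fun i => G (π (k + i)) ω) _ k step n
    simp only [add_zero] at c1
    have c2 := e3 (k + n)
    simp only [Pi.sub_apply] at c2
    have B0 : 0 ≤ 18 * (σ * (1 / 2) ^ k) * Q * V2 ω := by have := n2 ω; positivity
    have c3 : 18 * (σ * (1 / 2) ^ k) * Q * V2 ω * (4 - (2 * n + 4) * (1 / 2) ^ n)
        ≤ 18 * (σ * (1 / 2) ^ k) * Q * V2 ω * 4 := by
      gcongr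
      have : (0:ℝ) ≤ (2 * n + 4) * (1 / 2) ^ n := by positivity
      linarith
    have B1 : 0 ≤ (σ * (1 / 2) ^ k) * Q * V1 ω := by have := n1 ω; positivity
    have tri : |G x ω| ≤ |G (π k) ω| + |G (π (k + n)) ω - G (π k) ω| + |G x ω - G (π (k + n)) ω| := by
      calc |G x ω| = |G (π k) ω + (G (π (k + n)) ω - G (π k) ω) + (G x ω - G (π (k + n)) ω)| := by
            congr 1; ring
        _ ≤ _ := abs_add_three _ _ _
    nlinarith
  have lim : Filter.Tendsto (fun n : ℕ => 72 * σ * (1 / 2) ^ k * Q * (V1 ω + V2 ω)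
      + σ * (1 / 2) ^ (k + n) * Real.sqrt ((k + n : ℕ) + 1) * V3 ω) Filter.atTop
      (nhds (72 * σ * (1 / 2) ^ k * Q * (V1 ω + V2 ω) + 0)) := by
    refine tendsto_const_nhds.add ?_
    have l1 : Filter.Tendsto (fun m : ℕ => σ * (1 / 2) ^ m * Real.sqrt (m + 1) * V3 ω)
        Filter.atTop (nhds 0) := by
      have l2 : Filter.Tendsto (fun m : ℕ => σ * V3 ω * ((m:ℝ) * (1 / 2) ^ m + (1 / 2) ^ m))
          Filter.atTop (nhds (σ * V3 ω * (0 + 0))) :=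
        ((tendsto_self_mul_const_pow_of_lt_one (by norm_num) (by norm_num)).add
          (tendsto_pow_atTop_nhds_zero_of_lt_one (by norm_num) (by norm_num))).const_mul _
      rw [add_zero, mul_zero] at l2
      refine squeeze_zero (fun m => by have := n3 ω; positivity) (fun m => ?_) l2
      have : Real.sqrt ((m:ℝ) + 1) ≤ m + 1 := by
        apply Real.sqrt_le_iff.2 ⟨by positivity, ?_⟩
        have : (0:ℝ) ≤ m := by positivity
        nlinarith
      have := n3 ω
      calc _ ≤ σ * (1 / 2) ^ m * ((m:ℝ) + 1) * V3 ω := by gcongr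
        _ = _ := by ring
    have l3 := l1.comp (Filter.tendsto_add_atTop_nat k)
    refine l3.congr fun n => ?_
    simp only [Function.comp_apply, add_comm n k]
  rw [add_zero] at lim
  exact ge_of_tendsto' lim all

/-- Theorem 1, Part 1 of the paper: there is a universal constant C₀ (independent of the
dimension p, the compact domain Ω, the correlation function Ψ and its spectral density,
the variance σ², and the design) such that for the kriging predictor based on any fixed
design, `E[M] ≤ C₀ √(p (1 ∨ log(A₀ D_Ω)))`, where
`M = sup_{x∈Ω} (Z(x) − μ(x))/(σ(x) log^{1/2}(eσ/σ(x)))` (convention 0/0 = 0). -/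
theorem stmt0 :
    ∃ C₀ : ℝ,
      ∀ (p : ℕ), 0 < p →
      ∀ (Ω : Set (EuclideanSpace ℝ (Fin p))), IsCompact Ω → Ω.Nonempty →
        0 < Metric.diam Ω →
      ∀ (Ψ Ψt : EuclideanSpace ℝ (Fin p) → ℝ), IsSpectralDensity Ψ Ψt →
        Integrable (fun ω => (∑ i, |ω i|) * Ψt ω) →
      ∀ (σ : ℝ), 0 < σ →
      ∀ (Ω' : Type) [MeasurableSpace Ω'] (P : Measure Ω') [IsProbabilityMeasure P],
      ∀ (Z : EuclideanSpace ℝ (Fin p) → Ω' → ℝ),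
        (∀ x, Measurable (Z x)) →
        (∀ᵐ ω' ∂P, ContinuousOn (fun x => Z x ω') Ω) →
        GaussCov P Z σ Ψ →
      ∀ (n : ℕ) (xs : Fin n → EuclideanSpace ℝ (Fin p)),
        (∀ i, xs i ∈ Ω) → IsUnit (kmat Ψ xs).det →
        (∫ ω', (⨆ v : Ω, krigRatio Ψ xs σ (fun x => Z x ω') v) ∂P) ≤
          C₀ * Real.sqrt (p * max 1 (Real.log (A0 Ψt * Metric.diam Ω))) := by
  refine ⟨1728, ?_⟩
  intro p hp Ω hΩ hne hD Ψ Ψt hS hA σ hσ Ω' _ P _ Z hZm hZc hG n xs hxs hK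
  obtain ⟨hp0, hpe, hpn, -⟩ := spec_facts Ψ Ψt hS
  have hΨc := psi_cont Ψ Ψt hS
  obtain ⟨ζ, hζ⟩ := feature P Ψ Ψt hS Z σ hG
  set L := max 1 (Real.log (A0 Ψt * Metric.diam Ω)) with hL
  have hL1 : 1 ≤ L := le_max_left _ _
  set γ := kres Ψ xs ζ with hγ
  set G : EuclideanSpace ℝ (Fin p) → Ω' → ℝ :=
    fun x ω => Z x ω - kinterp Ψ xs (fun y => Z y ω) x with hGdef
  have hmem : ∀ x, (G x, γ x) ∈ Submodule.span ℝ (Set.range fun x => (Z x, ζ x)) :=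
    kres_span Ψ xs ζ Z
  choose T hT hcov using nets Ω hΩ.isBounded hne hD Ψ Ψt hS hA ζ σ hσ hζ L hL
  have hcon := kres_contr Ψ hpe xs ζ σ hζ hK
  obtain ⟨V, iV, nV, mV, eV⟩ := chain P Ω γ G
    (fun x => law_of_span P Z σ Ψ ζ hζ hG _ (hmem x))
    (fun x y => law_of_span P Z σ Ψ ζ hζ hG _ (Submodule.sub_mem _ (hmem x) (hmem y)))
    p hp L hL1 σ hσ T hT
    (fun j x hx => by
      obtain ⟨u, hu, h⟩ := hcov j x hx
      exact ⟨u, hu, (hcon x u).trans h⟩)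
  have hζc : Continuous ζ := by
    rw [continuous_iff_continuousAt]
    intro x
    rw [ContinuousAt, tendsto_iff_norm_sub_tendsto_zero]
    have e : ∀ y, ‖ζ y - ζ x‖ = Real.sqrt (2 * σ ^ 2 * (1 - Ψ (y - x))) := by
      intro y
      rw [← Real.sqrt_sq (norm_nonneg (ζ y - ζ x)), norm_sub_sq_real, ← real_inner_self_eq_norm_sq,
        ← real_inner_self_eq_norm_sq, hζ, hζ, hζ]
      simp only [sub_self, hp0]; congr 1; ring
    simp_rw [e]
    have : Continuous fun y => Real.sqrt (2 * σ ^ 2 * (1 - Ψ (y - x))) := by fun_prop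
    have := this.tendsto x
    simpa [hp0] using this
  have hγc : Continuous γ := by
    rw [hγ]; unfold kres; fun_prop
  obtain ⟨t, htΩ, htc, hdense⟩ := hΩ.isSeparable.exists_countable_dense_subset
  have hae : ∀ᵐ ω ∂P, ∀ x ∈ t, ∀ k : ℕ, ‖γ x‖ < 2 * σ * (1 / 2) ^ k →
        |G x ω| ≤ 72 * σ * (1 / 2) ^ k * Real.sqrt (p * (L + k)) * V ω := by
    rw [ae_ball_iff htc]
    exact fun x hx => eV x (htΩ hx)
  have hbound : ∀ᵐ ω ∂P, (⨆ v : Ω, krigRatio Ψ xs σ (fun x => Z x ω) v)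
      ≤ 216 * Real.sqrt (p * L) * V ω := by
    filter_upwards [hae, hZc] with ω hω hc
    have : Nonempty Ω := hne.to_subtype
    refine ciSup_le fun ⟨x, hx⟩ => ?_
    have hV := nV ω
    obtain ⟨hsd, hle⟩ := kres_norm Ψ hp0 hpe xs ζ σ hσ hζ hK x
    simp only [krigRatio]
    rw [hsd]
    rw [← hγ] at hle ⊢
    rcases (norm_nonneg (γ x)).eq_or_lt with h0 | h0
    · rw [← h0]; simp; positivity
    obtain ⟨k, hk1, hk2⟩ := exists_nat_pow_near_of_lt_one (x := ‖γ x‖ / σ) (y := (1 / 2 : ℝ))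
      (by positivity) (by rw [div_le_one hσ]; exact hle) (by norm_num) (by norm_num)
    rw [div_le_iff₀ hσ] at hk2
    rw [lt_div_iff₀ hσ] at hk1
    have hGb : |G x ω| ≤ 72 * σ * (1 / 2) ^ k * Real.sqrt (p * (L + k)) * V ω := by
      have hGc : ContinuousWithinAt (fun y => |G y ω|) t x := by
        have h1 : ContinuousWithinAt (fun y => Z y ω) t x := (hc x hx).mono htΩ
        have h2 : Continuous fun y => kinterp Ψ xs (fun y => Z y ω) y := by
          unfold kinterp; fun_prop
        exact (h1.sub h2.continuousWithinAt).abs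
      have hnb : (nhdsWithin x t).NeBot := mem_closure_iff_nhdsWithin_neBot.1 (hdense hx)
      refine le_of_tendsto hGc ?_
      have hopen : ∀ᶠ y in nhds x, ‖γ y‖ < 2 * σ * (1 / 2) ^ k := by
        refine hγc.norm.continuousAt.eventually_lt_const ?_
        have : 0 < σ * (1 / 2) ^ k := by positivity
        linarith
      filter_upwards [nhdsWithin_le_nhds hopen, self_mem_nhdsWithin] with y hy1 hy2
      exact hω y hy2 k hy1
    have hkp : (0:ℝ) ≤ k := by positivity
    have hlog : ((k:ℝ) + 1) / 2 ≤ Real.log (Real.exp 1 * σ / ‖γ x‖) := by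
      rw [mul_div_assoc, Real.log_mul (Real.exp_pos 1).ne' (by positivity), Real.log_exp]
      have h3 : (2:ℝ) ^ k ≤ σ / ‖γ x‖ := by
        rw [le_div_iff₀ h0]
        calc (2:ℝ) ^ k * ‖γ x‖ ≤ 2 ^ k * ((1 / 2) ^ k * σ) := by gcongr
          _ = σ := by rw [← mul_assoc, ← mul_pow]; norm_num
      have h4 := Real.log_le_log (by positivity) h3
      rw [Real.log_pow] at h4
      have := Real.log_two_gt_d9
      nlinarith
    set l := Real.log (Real.exp 1 * σ / ‖γ x‖) with hl
    have hlpos : 0 < l := by linarith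
    have hsl : 0 < Real.sqrt l := Real.sqrt_pos.2 hlpos
    rw [div_le_iff₀ (by positivity)]
    have h5 : Real.sqrt (p * (L + k)) ≤ 3 / 2 * (Real.sqrt (p * L) * Real.sqrt l) := by
      apply Real.sqrt_le_iff.2 ⟨by positivity, ?_⟩
      rw [mul_pow, mul_pow, Real.sq_sqrt (by positivity), Real.sq_sqrt hlpos.le]
      have : L + k ≤ L * (2 * l) := by nlinarith
      have hpp : (0:ℝ) ≤ p := by positivity
      have h6 : p * (L + k) ≤ p * (L * (2 * l)) := by gcongr
      have h7 : 0 ≤ p * L * l := by positivity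
      nlinarith
    have h8 : σ * (1 / 2) ^ k ≤ 2 * ‖γ x‖ := by
      rw [pow_succ] at hk1; linarith
    calc _ ≤ |G x ω| := le_abs_self _
      _ ≤ 72 * σ * (1 / 2) ^ k * Real.sqrt (p * (L + k)) * V ω := hGb
      _ = 72 * (σ * (1 / 2) ^ k) * Real.sqrt (p * (L + k)) * V ω := by ring
      _ ≤ 72 * (2 * ‖γ x‖) * (3 / 2 * (Real.sqrt (p * L) * Real.sqrt l)) * V ω := by gcongr
      _ = _ := by ring
  have hR : ∫ ω, 216 * Real.sqrt (p * L) * V ω ∂P ≤ 1728 * Real.sqrt (p * L) := by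
    rw [integral_const_mul]
    have := Real.sqrt_nonneg (p * L)
    nlinarith
  by_cases hIntg : Integrable (fun ω => ⨆ v : Ω, krigRatio Ψ xs σ (fun x => Z x ω) v) P
  · exact (integral_mono_ae hIntg (iV.const_mul _) hbound).trans hR
  · rw [integral_undef hIntg]; positivity
end

section
/- For every t > 0, P(M − E[M] > t) ≤ e^{−t²/2}, where M = sup_{x∈Ω} (Z(x) − μ(x)) / (σ(x) · log^{1/2}(e σ / σ(x))) with the convention 0/0 = 0. -/
open MeasureTheory ProbabilityTheory
open scoped RealInnerProductSpace

open Set in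
lemma bm_compact {K L C : Set ℝ} (hK : IsCompact K) (hL : IsCompact L) (hKn : K.Nonempty)
    (hLn : L.Nonempty) (hC : ∀ a ∈ K, ∀ b ∈ L, a + b ∈ C) :
    volume K + volume L ≤ volume C := by
  have ha := hK.sSup_mem hKn
  have hb := hL.sInf_mem hLn
  set a := sSup K with hadef
  set b := sInf L with hbdef
  have h1 : volume ((fun z => z + -b) ⁻¹' K) = volume K := measure_preimage_add_right _ _ _
  have h2 : volume ((fun z => z + -a) ⁻¹' L) = volume L := measure_preimage_add_right _ _ _
  have hm : MeasurableSet ((fun z => z + -a) ⁻¹' L) :=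
    (measurable_add_const _) hL.measurableSet
  have hIntg : volume (((fun z => z + -b) ⁻¹' K) ∩ ((fun z => z + -a) ⁻¹' L)) = 0 := by
    refine measure_mono_null (t := {a + b}) ?_ (by simp)
    rintro z ⟨hz1, hz2⟩
    have e1 : z + -b ≤ a := le_csSup hK.bddAbove hz1
    have e2 : b ≤ z + -a := csInf_le hL.bddBelow hz2
    simp only [mem_singleton_iff]; linarith
  rw [← h1, ← h2, ← measure_union_add_inter _ hm, hIntg, add_zero]
  refine measure_mono ?_
  rintro z (hz | hz)
  · have := hC _ hz _ hb
    simpa using this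
  · have := hC _ ha _ hz
    simpa using this

open Set in
lemma bm_one {A B C : Set ℝ} (hA : MeasurableSet A) (hB : MeasurableSet B) (hAn : A.Nonempty)
    (hBn : B.Nonempty) (hC : ∀ a ∈ A, ∀ b ∈ B, a + b ∈ C) :
    volume A + volume B ≤ volume C := by
  obtain ⟨a₀, ha₀⟩ := hAn
  obtain ⟨b₀, hb₀⟩ := hBn
  refine le_of_forall_lt fun r hr => ?_
  obtain ⟨r1, r2, h1, h2, h3⟩ : ∃ r1 r2 : ENNReal, (r1 < volume A ∨ r1 = 0) ∧
      (r2 < volume B ∨ r2 = 0) ∧ r < r1 + r2 := by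
    by_cases hA0 : volume A = 0
    · rw [hA0, zero_add] at hr
      obtain ⟨q, hq1, hq2⟩ := exists_between hr
      exact ⟨0, q, Or.inr rfl, Or.inl hq2, by simpa⟩
    by_cases hB0 : volume B = 0
    · rw [hB0, add_zero] at hr
      obtain ⟨q, hq1, hq2⟩ := exists_between hr
      exact ⟨q, 0, Or.inl hq2, Or.inr rfl, by simpa⟩
    obtain ⟨r1, hr1, r2, hr2, h⟩ := ENNReal.exists_lt_add_of_lt_add hr hA0 hB0
    exact ⟨r1, r2, Or.inl hr1, Or.inl hr2, h⟩
  have key : ∀ (A : Set ℝ) (hA : MeasurableSet A) (a₀ : ℝ) (ha₀ : a₀ ∈ A) (r1 : ENNReal)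
      (h1 : r1 < volume A ∨ r1 = 0), ∃ K ⊆ A, IsCompact K ∧ K.Nonempty ∧ r1 ≤ volume K := by
    intro A hA a₀ ha₀ r1 h1
    rcases h1 with h1 | h1
    · obtain ⟨K, hKA, hK, hKr⟩ := hA.exists_lt_isCompact h1
      refine ⟨K, hKA, hK, ?_, hKr.le⟩
      by_contra hne
      rw [not_nonempty_iff_eq_empty] at hne
      simp [hne] at hKr
    · exact ⟨{a₀}, by simpa, isCompact_singleton, by simp, by simp [h1]⟩
  obtain ⟨K, hKA, hK, hKn, hKr⟩ := key A hA a₀ ha₀ r1 h1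
  obtain ⟨L, hLB, hL, hLn, hLr⟩ := key B hB b₀ hb₀ r2 h2
  calc r < r1 + r2 := h3
    _ ≤ volume K + volume L := by gcongr
    _ ≤ volume C := bm_compact hK hL hKn hLn (fun a ha b hb => hC a (hKA ha) b (hLB hb))

lemma bm_scaled {A B C : Set ℝ} {s : ℝ} (hs0 : 0 < s) (hs1 : s < 1)
    (hA : MeasurableSet A) (hB : MeasurableSet B) (hAn : A.Nonempty)
    (hBn : B.Nonempty) (hC : ∀ a ∈ A, ∀ b ∈ B, (1 - s) * a + s * b ∈ C) :
    ENNReal.ofReal (1 - s) * volume A + ENNReal.ofReal s * volume B ≤ volume C := by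
  have h1 : (1 - s) ≠ 0 := by linarith
  have e1 := Measure.addHaar_smul (volume : Measure ℝ) (1 - s) A
  have e2 := Measure.addHaar_smul (volume : Measure ℝ) s B
  simp only [Module.finrank_self, pow_one] at e1 e2
  rw [abs_of_pos (by linarith)] at e1
  rw [abs_of_pos hs0] at e2
  rw [← e1, ← e2]
  refine bm_one (hA.const_smul₀ _) (hB.const_smul₀ _) hAn.smul_set hBn.smul_set ?_
  rintro _ ⟨a, ha, rfl⟩ _ ⟨b, hb, rfl⟩
  exact hC a ha b hb

lemma ennreal_amgm (a b : ENNReal) {s : ℝ} (hs0 : 0 < s) (hs1 : s < 1) :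
    a ^ (1 - s) * b ^ s ≤ ENNReal.ofReal (1 - s) * a + ENNReal.ofReal s * b := by
  have h1 : 0 < 1 - s := by linarith
  by_cases ha : a = ⊤
  · subst ha
    rw [ENNReal.mul_top (by simpa using hs1)]; simp
  by_cases hb : b = ⊤
  · subst hb
    rw [ENNReal.mul_top (by simpa using hs0)]; simp
  lift a to NNReal using ha
  lift b to NNReal using hb
  have := Real.geom_mean_le_arith_mean2_weighted h1.le hs0.le (NNReal.coe_nonneg a) (NNReal.coe_nonneg b) (by ring)
  have h2 := ENNReal.ofReal_le_ofReal this
  rw [ENNReal.ofReal_add (by positivity) (by positivity), ENNReal.ofReal_mul (by positivity),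
    ENNReal.ofReal_mul (by positivity), ENNReal.ofReal_mul (by positivity),
    ← ENNReal.ofReal_rpow_of_nonneg (NNReal.coe_nonneg a) h1.le, ← ENNReal.ofReal_rpow_of_nonneg (NNReal.coe_nonneg b) hs0.le] at h2
  simpa using h2

open Set in
/-- Normalized one-dimensional Prekopa-Leindler. -/
lemma pl_norm {u v h : ℝ → ℝ} {s : ℝ} (hs0 : 0 < s) (hs1 : s < 1)
    (hu : Measurable u) (hv : Measurable v) (hh : Measurable h)
    (hu0 : ∀ x, 0 ≤ u x) (hv0 : ∀ x, 0 ≤ v x) (hh0 : ∀ x, 0 ≤ h x)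
    (hu1 : ∀ x, u x ≤ 1) (hv1 : ∀ x, v x ≤ 1)
    (hus : ∀ r < 1, ∃ x, r < u x) (hvs : ∀ r < 1, ∃ x, r < v x)
    (H : ∀ x y, u x ^ (1 - s) * v y ^ s ≤ h ((1 - s) * x + s * y)) :
    ENNReal.ofReal (1 - s) * (∫⁻ x, ENNReal.ofReal (u x)) +
      ENNReal.ofReal s * (∫⁻ x, ENNReal.ofReal (v x)) ≤ ∫⁻ x, ENNReal.ofReal (h x) := by
  have h1s : 0 < 1 - s := by linarith
  have meas : ∀ f : ℝ → ℝ, Measurable (fun t : ℝ => volume {a | t < f a}) := by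
    intro f
    apply Antitone.measurable
    intro a b hab
    exact measure_mono fun x hx => lt_of_le_of_lt hab hx
  rw [lintegral_eq_lintegral_meas_lt _ (Filter.Eventually.of_forall hu0) hu.aemeasurable,
    lintegral_eq_lintegral_meas_lt _ (Filter.Eventually.of_forall hv0) hv.aemeasurable,
    lintegral_eq_lintegral_meas_lt _ (Filter.Eventually.of_forall hh0) hh.aemeasurable,
    ← lintegral_const_mul _ (meas u), ← lintegral_const_mul _ (meas v),
    ← lintegral_add_left ((meas u).const_mul _)]
  refine setLIntegral_mono' measurableSet_Ioi fun r hr => ?_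
  have hr0 : 0 < r := hr
  by_cases hr1 : r < 1
  · refine bm_scaled hs0 hs1 (hu measurableSet_Ioi) (hv measurableSet_Ioi) (hus r hr1) (hvs r hr1) ?_
    intro a ha b hb
    have ha' : r < u a := ha
    have hb' : r < v b := hb
    refine lt_of_lt_of_le ?_ (H a b)
    calc r = r ^ (1 - s) * r ^ s := by
          rw [← Real.rpow_add hr0]; simp
      _ < u a ^ (1 - s) * v b ^ s := by
          apply mul_lt_mul'' <;> first | positivity | exact Real.rpow_lt_rpow hr0.le (by assumption) (by assumption)
  · have e1 : {a | r < u a} = ∅ := by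
      ext x; simp; linarith [hu1 x]
    have e2 : {a | r < v a} = ∅ := by
      ext x; simp; linarith [hv1 x]
    simp [e1, e2]

open Set in
/-- One-dimensional Prekopa-Leindler for bounded functions. -/
lemma pl_bdd {u v h : ℝ → ℝ} {s : ℝ} (hs0 : 0 < s) (hs1 : s < 1)
    (hu : Measurable u) (hv : Measurable v) (hh : Measurable h)
    (hu0 : ∀ x, 0 ≤ u x) (hv0 : ∀ x, 0 ≤ v x) (hh0 : ∀ x, 0 ≤ h x)
    (hub : BddAbove (range u)) (hvb : BddAbove (range v))
    (H : ∀ x y, u x ^ (1 - s) * v y ^ s ≤ h ((1 - s) * x + s * y)) :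
    (∫⁻ x, ENNReal.ofReal (u x)) ^ (1 - s) * (∫⁻ x, ENNReal.ofReal (v x)) ^ s
      ≤ ∫⁻ x, ENNReal.ofReal (h x) := by
  have h1s : 0 < 1 - s := by linarith
  set U := ⨆ x, u x with hU
  set V := ⨆ x, v x with hV
  have huU : ∀ x, u x ≤ U := fun x => le_ciSup hub x
  have hvV : ∀ x, v x ≤ V := fun x => le_ciSup hvb x
  rcases (le_trans (hu0 0) (huU 0)).eq_or_lt with hU0 | hU0
  · have : ∀ x, u x = 0 := fun x => le_antisymm (hU0 ▸ huU x) (hu0 x)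
    simp [this, h1s]
  rcases (le_trans (hv0 0) (hvV 0)).eq_or_lt with hV0 | hV0
  · have : ∀ x, v x = 0 := fun x => le_antisymm (hV0 ▸ hvV x) (hv0 x)
    simp [this, hs0]
  set W := U ^ (1 - s) * V ^ s with hW
  have hW0 : 0 < W := by positivity
  have key := pl_norm (u := fun x => u x / U) (v := fun x => v x / V) (h := fun x => h x / W)
    hs0 hs1 (hu.div_const _) (hv.div_const _) (hh.div_const _)
    (fun x => div_nonneg (hu0 x) hU0.le) (fun x => div_nonneg (hv0 x) hV0.le)
    (fun x => div_nonneg (hh0 x) hW0.le)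
    (fun x => (div_le_one hU0).2 (huU x)) (fun x => (div_le_one hV0).2 (hvV x))
    (by
      intro r hr
      obtain ⟨x, hx⟩ := exists_lt_of_lt_ciSup (show r * U < ⨆ x, u x by
        rw [← hU]; nlinarith)
      exact ⟨x, (lt_div_iff₀ hU0).2 hx⟩)
    (by
      intro r hr
      obtain ⟨x, hx⟩ := exists_lt_of_lt_ciSup (show r * V < ⨆ x, v x by
        rw [← hV]; nlinarith)
      exact ⟨x, (lt_div_iff₀ hV0).2 hx⟩)
    (by
      intro x y
      rw [Real.div_rpow (hu0 x) hU0.le, Real.div_rpow (hv0 y) hV0.le, div_mul_div_comm]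
      gcongr
      exact H x y)
  have key2 := (ennreal_amgm _ _ hs0 hs1).trans key
  have conv : ∀ (f : ℝ → ℝ) (hf : Measurable f) (c : ℝ) (hc : 0 < c), ∫⁻ x, ENNReal.ofReal (f x) =
      ENNReal.ofReal c * ∫⁻ x, ENNReal.ofReal (f x / c) := by
    intro f hf c hc
    rw [← lintegral_const_mul _ (hf.div_const c).ennreal_ofReal]
    congr 1; ext x
    rw [← ENNReal.ofReal_mul hc.le]; congr 1; field_simp
  rw [conv u hu U hU0, conv v hv V hV0, conv h hh W hW0, ENNReal.mul_rpow_of_nonneg _ _ h1s.le,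
    ENNReal.mul_rpow_of_nonneg _ _ hs0.le, mul_mul_mul_comm,
    ENNReal.ofReal_rpow_of_nonneg hU0.le h1s.le, ENNReal.ofReal_rpow_of_nonneg hV0.le hs0.le,
    ← ENNReal.ofReal_mul (by positivity)]
  gcongr


/-- Transport-type (dual) inequality with cost `c`, parameter `s`. -/
def PLGood {E : Type*} [MeasurableSpace E] (s : ℝ) (μ : Measure E) (c : E → E → ℝ) : Prop :=
  ∀ (K : ℝ), 0 ≤ K → ∀ u v : E → ENNReal, Measurable u → Measurable v →
    (∀ x y, u x ^ (1 - s) * v y ^ s ≤ ENNReal.ofReal (K * Real.exp (c x y))) →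
    (∫⁻ x, u x ∂μ) ^ (1 - s) * (∫⁻ x, v x ∂μ) ^ s ≤ ENNReal.ofReal K

lemma plgood_trunc {u : ℝ → ENNReal} (hu : Measurable u) (μ : Measure ℝ) :
    Filter.Tendsto (fun N : ℕ => ∫⁻ x, min (u x) (N : ENNReal) ∂μ) Filter.atTop
      (nhds (∫⁻ x, u x ∂μ)) := by
  apply lintegral_tendsto_of_tendsto_of_monotone
  · intro n; exact (hu.min measurable_const).aemeasurable
  · refine Filter.Eventually.of_forall fun x a b hab => ?_
    exact min_le_min le_rfl (by exact_mod_cast hab)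
  · refine Filter.Eventually.of_forall fun x => ?_
    have : Filter.Tendsto (fun N : ℕ => min (u x) (N : ENNReal)) Filter.atTop
        (nhds (min (u x) ⊤)) := tendsto_const_nhds.min ENNReal.tendsto_nat_nhds_top
    simpa using this

lemma plgood_gauss {s : ℝ} (hs0 : 0 < s) (hs1 : s < 1) :
    PLGood s (gaussianReal 0 1) (fun x y => s * (1 - s) * (x - y) ^ 2 / 2) := by
  intro K hK u v hu hv H
  have h1s : 0 < 1 - s := by linarith
  set φ := gaussianPDFReal 0 1 with hφ
  have hφ0 : ∀ x, 0 ≤ φ x := fun x => gaussianPDFReal_nonneg 0 1 x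
  have hφm : Measurable φ := measurable_gaussianPDFReal 0 1
  have hφb : ∀ x, φ x ≤ 1 := by
    intro x
    simp only [hφ, gaussianPDFReal]
    have h1 : (√(2 * Real.pi * ((1 : NNReal) : ℝ)))⁻¹ ≤ 1 := by
      apply inv_le_one_of_one_le₀
      rw [Real.one_le_sqrt]
      have := Real.pi_gt_three
      simp; linarith
    have h2 : Real.exp (-(x - 0) ^ 2 / (2 * ((1 : NNReal) : ℝ))) ≤ 1 := by
      rw [Real.exp_le_one_iff]
      have := sq_nonneg x
      simp; linarith
    exact mul_le_one₀ h1 (Real.exp_pos _).le h2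
  have hφmul : ∀ x y, φ x ^ (1 - s) * φ y ^ s * Real.exp (s * (1 - s) * (x - y) ^ 2 / 2) =
      φ ((1 - s) * x + s * y) := by
    intro x y
    simp only [hφ, gaussianPDFReal]
    set C := (√(2 * Real.pi * ((1 : NNReal) : ℝ)))⁻¹ with hC
    have hC0 : 0 < C := by positivity
    rw [Real.mul_rpow hC0.le (Real.exp_pos _).le, Real.mul_rpow hC0.le (Real.exp_pos _).le,
      ← Real.exp_mul, ← Real.exp_mul]
    have : C ^ (1 - s) * C ^ s = C := by
      rw [← Real.rpow_add hC0]; simp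
    calc _ = (C ^ (1 - s) * C ^ s) * (Real.exp (-(x - 0) ^ 2 / (2 * ((1 : NNReal) : ℝ)) * (1 - s)) *
          Real.exp (-(y - 0) ^ 2 / (2 * ((1 : NNReal) : ℝ)) * s) *
          Real.exp (s * (1 - s) * (x - y) ^ 2 / 2)) := by ring
      _ = _ := by
        rw [this, ← Real.exp_add, ← Real.exp_add]
        congr 2
        simp only [NNReal.coe_one]
        ring
  have hIntg : ∀ w : ℝ → ENNReal, Measurable w → ∫⁻ x, w x ∂(gaussianReal 0 1) =
      ∫⁻ x, ENNReal.ofReal (φ x) * w x := by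
    intro w hw
    rw [gaussianReal_of_var_ne_zero 0 one_ne_zero,
      lintegral_withDensity_eq_lintegral_mul _ (measurable_gaussianPDF 0 1) hw]
    rfl
  have hφint : ∫⁻ x, ENNReal.ofReal (φ x) = 1 := by
    have := hIntg (fun _ => 1) measurable_const
    simpa using this.symm
  have step : ∀ N : ℕ, (∫⁻ x, min (u x) (N : ENNReal) ∂(gaussianReal 0 1)) ^ (1 - s) *
      (∫⁻ x, min (v x) (N : ENNReal) ∂(gaussianReal 0 1)) ^ s ≤ ENNReal.ofReal K := by
    intro N
    have hfin : ∀ w : ENNReal, min w (N : ENNReal) ≠ ⊤ := fun w =>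
      ne_top_of_le_ne_top (ENNReal.natCast_ne_top N) (min_le_right _ _)
    have hle : ∀ w : ENNReal, (min w (N : ENNReal)).toReal ≤ N := by
      intro w
      have := ENNReal.toReal_mono (ENNReal.natCast_ne_top N) (min_le_right w (N : ENNReal))
      simpa using this
    have hum := (hu.min (measurable_const (a := (N : ENNReal))))
    have hvm := (hv.min (measurable_const (a := (N : ENNReal))))
    have hbdd : ∀ w : ℝ → ENNReal,
        BddAbove (Set.range fun x => φ x * (min (w x) (N : ENNReal)).toReal) := by
      intro w
      refine ⟨N, ?_⟩
      rintro _ ⟨x, rfl⟩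
      calc φ x * (min (w x) (N : ENNReal)).toReal ≤ 1 * N :=
            mul_le_mul (hφb x) (hle _) ENNReal.toReal_nonneg zero_le_one
        _ = N := one_mul _
    have key := pl_bdd (u := fun x => φ x * (min (u x) (N : ENNReal)).toReal)
      (v := fun x => φ x * (min (v x) (N : ENNReal)).toReal) (h := fun x => K * φ x) hs0 hs1
      (hφm.mul hum.ennreal_toReal) (hφm.mul hvm.ennreal_toReal)
      (hφm.const_mul K) (fun x => mul_nonneg (hφ0 x) ENNReal.toReal_nonneg)
      (fun x => mul_nonneg (hφ0 x) ENNReal.toReal_nonneg) (fun x => mul_nonneg hK (hφ0 x))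
      (hbdd u) (hbdd v) (by
        intro x y
        have h1 : (min (u x) (N : ENNReal)) ^ (1 - s) * (min (v y) (N : ENNReal)) ^ s ≤
            ENNReal.ofReal (K * Real.exp (s * (1 - s) * (x - y) ^ 2 / 2)) := by
          refine le_trans ?_ (H x y)
          gcongr <;> exact min_le_left _ _
        have h2 := ENNReal.toReal_mono ENNReal.ofReal_ne_top h1
        rw [ENNReal.toReal_mul, ← ENNReal.toReal_rpow, ← ENNReal.toReal_rpow,
          ENNReal.toReal_ofReal (by positivity)] at h2
        rw [Real.mul_rpow (hφ0 x) ENNReal.toReal_nonneg,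
          Real.mul_rpow (hφ0 y) ENNReal.toReal_nonneg, ← hφmul x y]
        have h3 : 0 ≤ φ x ^ (1 - s) * φ y ^ s :=
          mul_nonneg (Real.rpow_nonneg (hφ0 x) _) (Real.rpow_nonneg (hφ0 y) _)
        have h4 := mul_le_mul_of_nonneg_left h2 h3
        calc _ = _ := by ring
          _ ≤ _ := h4
          _ = _ := by ring)
    have conv : ∀ w : ℝ → ENNReal, Measurable w →
        ∫⁻ x, ENNReal.ofReal (φ x * (min (w x) (N : ENNReal)).toReal) =
        ∫⁻ x, min (w x) (N : ENNReal) ∂(gaussianReal 0 1) := by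
      intro w hw
      rw [hIntg _ (hw.min measurable_const)]
      congr 1; ext x
      rw [ENNReal.ofReal_mul (hφ0 x), ENNReal.ofReal_toReal (hfin _)]
    rw [conv u hu, conv v hv] at key
    refine key.trans (le_of_eq ?_)
    simp_rw [ENNReal.ofReal_mul hK]
    rw [lintegral_const_mul _ hφm.ennreal_ofReal, hφint, mul_one]
  by_cases hu0 : ∫⁻ x, u x ∂(gaussianReal 0 1) = 0
  · simp [hu0, h1s]
  by_cases hv0 : ∫⁻ x, v x ∂(gaussianReal 0 1) = 0
  · simp [hv0, hs0]
  refine le_of_tendsto (ENNReal.Tendsto.mul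
    ((plgood_trunc hu _).ennrpow_const (1 - s)) (Or.inl ?_)
    ((plgood_trunc hv _).ennrpow_const s) (Or.inl ?_)) (Filter.Eventually.of_forall step)
  · simp [ENNReal.rpow_eq_zero_iff, hu0, hs1.le]
  · simp [ENNReal.rpow_eq_zero_iff, hv0, hs0.le]

lemma plgood_prod {E F : Type*} [MeasurableSpace E] [MeasurableSpace F] {s : ℝ}
    {μ : Measure E} {ν : Measure F} [SFinite μ] [SFinite ν] {c : E → E → ℝ} {d : F → F → ℝ}
    (h1 : PLGood s μ c) (h2 : PLGood s ν d) :
    PLGood s (μ.prod ν) (fun x y => c x.1 y.1 + d x.2 y.2) := by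
  intro K hK u v hu hv H
  rw [lintegral_prod _ hu.aemeasurable, lintegral_prod _ hv.aemeasurable]
  refine h1 K hK _ _ hu.lintegral_prod_right' hv.lintegral_prod_right' fun x y => ?_
  refine h2 _ (by positivity) _ _ (hu.comp measurable_prodMk_left)
    (hv.comp measurable_prodMk_left) fun x' y' => ?_
  have := H (x, x') (y, y')
  simpa [Real.exp_add, mul_assoc] using this

lemma plgood_pi {s : ℝ} (hs0 : 0 < s) (hs1 : s < 1) (d : ℕ) :
    PLGood s (Measure.pi (fun _ : Fin d => gaussianReal 0 1))
      (fun x y => s * (1 - s) * (∑ i, (x i - y i) ^ 2) / 2) := by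
  induction d with
  | zero =>
    intro K hK u v hu hv H
    have := H (fun i => i.elim0) (fun i => i.elim0)
    have e : ∀ w : (Fin 0 → ℝ) → ENNReal, ∫⁻ x, w x ∂(Measure.pi (fun _ : Fin 0 => gaussianReal 0 1))
        = w (fun i => i.elim0) := by
      intro w
      rw [Measure.pi_of_empty _ (fun i => i.elim0)]
      simp
    rw [e, e]
    simpa using this
  | succ d ih =>
    intro K hK u v hu hv H
    have mp := (measurePreserving_piFinSuccAbove (fun _ : Fin (d + 1) => gaussianReal 0 1) 0).symm
    have g := plgood_prod (plgood_gauss hs0 hs1) ih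
    rw [← mp.lintegral_comp hu, ← mp.lintegral_comp hv]
    refine g K hK _ _ (hu.comp mp.measurable) (hv.comp mp.measurable) fun x y => ?_
    refine (H _ _).trans (le_of_eq ?_)
    congr 3
    beta_reduce
    rw [Fin.sum_univ_succ]
    simp [MeasurableEquiv.piFinSuccAbove, Fin.insertNthEquiv]
    ring

section Lip
variable {d : ℕ} {F : (Fin d → ℝ) → ℝ}

lemma lip_pl (hF : Measurable F) (hL : ∀ x y, (F x - F y) ^ 2 ≤ ∑ i, (x i - y i) ^ 2)
    {s : ℝ} (hs0 : 0 < s) (hs1 : s < 1) (m : ℝ) :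
    (∫⁻ x, ENNReal.ofReal (Real.exp (-(s * m) * F x)) ∂(Measure.pi (fun _ : Fin d => gaussianReal 0 1)))
        ^ (1 - s) *
      (∫⁻ x, ENNReal.ofReal (Real.exp (((1 - s) * m) * F x))
        ∂(Measure.pi (fun _ : Fin d => gaussianReal 0 1))) ^ s ≤
      ENNReal.ofReal (Real.exp (s * (1 - s) * m ^ 2 / 2)) := by
  have h1s : 0 < 1 - s := by linarith
  refine plgood_pi hs0 hs1 d _ (Real.exp_pos _).le _ _ (by fun_prop) (by fun_prop) fun x y => ?_
  rw [ENNReal.ofReal_rpow_of_nonneg (Real.exp_pos _).le h1s.le,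
    ENNReal.ofReal_rpow_of_nonneg (Real.exp_pos _).le hs0.le,
    ← ENNReal.ofReal_mul (Real.rpow_nonneg (Real.exp_pos _).le _), ← Real.exp_mul, ← Real.exp_mul,
    ← Real.exp_add, ← Real.exp_add]
  apply ENNReal.ofReal_le_ofReal
  apply Real.exp_le_exp.2
  have h1 := hL x y
  have h2 : m * (F y - F x) ≤ (m ^ 2 + ∑ i, (x i - y i) ^ 2) / 2 := by
    nlinarith [sq_nonneg (m - (F y - F x))]
  have h3 := mul_le_mul_of_nonneg_left h2 (mul_pos hs0 h1s).le
  calc _ = s * (1 - s) * (m * (F y - F x)) := by ring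
    _ ≤ _ := h3
    _ = _ := by ring

lemma lip_int_exp (hF : Measurable F) (hL : ∀ x y, (F x - F y) ^ 2 ≤ ∑ i, (x i - y i) ^ 2)
    (θ : ℝ) : Integrable (fun x => Real.exp (θ * F x))
      (Measure.pi (fun _ : Fin d => gaussianReal 0 1)) := by
  have h := lip_pl hF hL (s := 1 / 2) (by norm_num) (by norm_num) (2 * θ)
  have hne : (∫⁻ x, ENNReal.ofReal (Real.exp (-(1 / 2 * (2 * θ)) * F x))
      ∂(Measure.pi (fun _ : Fin d => gaussianReal 0 1))) ≠ 0 := by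
    intro h0
    rw [lintegral_eq_zero_iff (by fun_prop)] at h0
    have : ∀ᵐ x ∂(Measure.pi (fun _ : Fin d => gaussianReal 0 1)), False := by
      filter_upwards [h0] with x hx
      have := Real.exp_pos (-(1 / 2 * (2 * θ)) * F x)
      simp only [Pi.zero_apply, ENNReal.ofReal_eq_zero] at hx
      linarith
    simp at this
    exact IsProbabilityMeasure.ne_zero _ this
  have hfin : (∫⁻ x, ENNReal.ofReal (Real.exp (((1 - 1 / 2) * (2 * θ)) * F x))
      ∂(Measure.pi (fun _ : Fin d => gaussianReal 0 1))) ≠ ⊤ := by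
    intro htop
    rw [htop, ENNReal.top_rpow_of_pos (by norm_num), ENNReal.mul_top] at h
    · simp at h
    · rw [Ne, ENNReal.rpow_eq_zero_iff]
      push Not
      exact ⟨fun h => absurd h hne, fun _ => by norm_num⟩
  have e : ((1 - 1 / 2) * (2 * θ)) = θ := by ring
  rw [e] at hfin
  refine ⟨by fun_prop, ?_⟩
  rw [hasFiniteIntegral_iff_ofReal (Filter.Eventually.of_forall fun x => (Real.exp_pos _).le)]
  exact lt_top_iff_ne_top.2 hfin

lemma lip_int (hF : Measurable F) (hL : ∀ x y, (F x - F y) ^ 2 ≤ ∑ i, (x i - y i) ^ 2) :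
    Integrable F (Measure.pi (fun _ : Fin d => gaussianReal 0 1)) := by
  have h1 := lip_int_exp hF hL 1
  have h2 := lip_int_exp hF hL (-1)
  refine (h1.add h2).mono' hF.aestronglyMeasurable (Filter.Eventually.of_forall fun x => ?_)
  simp only [Pi.add_apply, Real.norm_eq_abs, one_mul, neg_mul]
  have := Real.add_one_le_exp (F x)
  have := Real.add_one_le_exp (-F x)
  have := Real.exp_pos (F x)
  have := Real.exp_pos (-F x)
  rw [abs_le]; constructor <;> linarith

lemma lip_mgf (hF : Measurable F) (hL : ∀ x y, (F x - F y) ^ 2 ≤ ∑ i, (x i - y i) ^ 2) (θ : ℝ) :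
    ∫ x, Real.exp (θ * F x) ∂(Measure.pi (fun _ : Fin d => gaussianReal 0 1)) ≤
      Real.exp (θ * (∫ x, F x ∂(Measure.pi (fun _ : Fin d => gaussianReal 0 1))) + θ ^ 2 / 2) := by
  set γ := Measure.pi (fun _ : Fin d => gaussianReal 0 1) with hγ
  have hIntg := lip_int hF hL
  have main : ∀ s : ℝ, 0 < s → s < 1 → ∫ x, Real.exp (θ * F x) ∂γ ≤
      Real.exp (θ * (∫ x, F x ∂γ) + θ ^ 2 / (2 * (1 - s))) := by
    intro s hs0 hs1
    have h1s : 0 < 1 - s := by linarith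
    have h := lip_pl hF hL hs0 hs1 (θ / (1 - s))
    have e1 : (1 - s) * (θ / (1 - s)) = θ := by field_simp
    rw [e1] at h
    have conv : ∀ a : ℝ, ∫⁻ x, ENNReal.ofReal (Real.exp (a * F x)) ∂γ =
        ENNReal.ofReal (∫ x, Real.exp (a * F x) ∂γ) := by
      intro a
      rw [ofReal_integral_eq_lintegral_ofReal (lip_int_exp hF hL a)
        (Filter.Eventually.of_forall fun x => (Real.exp_pos _).le)]
    have nn : ∀ a : ℝ, 0 ≤ ∫ x, Real.exp (a * F x) ∂γ := fun a =>
      integral_nonneg fun x => (Real.exp_pos _).le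
    rw [conv, conv, ENNReal.ofReal_rpow_of_nonneg (nn _) h1s.le,
      ENNReal.ofReal_rpow_of_nonneg (nn _) hs0.le, ← ENNReal.ofReal_mul (Real.rpow_nonneg (nn _) _),
      ENNReal.ofReal_le_ofReal_iff (Real.exp_pos _).le] at h
    have jensen : Real.exp (-(s * (θ / (1 - s))) * ∫ x, F x ∂γ) ≤
        ∫ x, Real.exp (-(s * (θ / (1 - s))) * F x) ∂γ := by
      rw [← integral_const_mul]
      exact convexOn_exp.map_integral_le Real.continuous_exp.continuousOn isClosed_univ
        (by simp) (hIntg.const_mul _) (lip_int_exp hF hL _)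
    set M := ∫ x, F x ∂γ with hM
    have h2 : Real.exp (-(s * (θ / (1 - s))) * M) ^ (1 - s) * (∫ x, Real.exp (θ * F x) ∂γ) ^ s ≤
        Real.exp (s * (1 - s) * (θ / (1 - s)) ^ 2 / 2) := by
      refine le_trans ?_ h
      gcongr
    rw [← Real.exp_mul] at h2
    have h3 : (∫ x, Real.exp (θ * F x) ∂γ) ^ s ≤
        (Real.exp (θ * M + θ ^ 2 / (2 * (1 - s)))) ^ s := by
      rw [← Real.exp_mul]
      have h4 := mul_le_mul_of_nonneg_left h2
        (Real.exp_pos (s * θ * M)).le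
      rw [← mul_assoc, ← Real.exp_add, ← Real.exp_add] at h4
      have e2 : s * θ * M + -(s * (θ / (1 - s))) * M * (1 - s) = 0 := by field_simp; ring
      rw [e2, Real.exp_zero, one_mul] at h4
      refine h4.trans (le_of_eq ?_)
      congr 1
      field_simp
    exact (Real.rpow_le_rpow_iff (nn _) (Real.exp_pos _).le hs0).1 h3
  have lim : Filter.Tendsto (fun s : ℝ => Real.exp (θ * (∫ x, F x ∂γ) + θ ^ 2 / (2 * (1 - s))))
      (nhdsWithin 0 (Set.Ioi 0)) (nhds (Real.exp (θ * (∫ x, F x ∂γ) + θ ^ 2 / 2))) := by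
    have : ContinuousAt (fun s : ℝ => Real.exp (θ * (∫ x, F x ∂γ) + θ ^ 2 / (2 * (1 - s)))) 0 := by
      have h0 : (2 * (1 - (0 : ℝ))) ≠ 0 := by norm_num
      fun_prop (disch := exact h0)
    have h := this.tendsto
    simp only [sub_zero, mul_one] at h
    exact h.mono_left nhdsWithin_le_nhds
  refine ge_of_tendsto lim ?_
  filter_upwards [Ioo_mem_nhdsGT (show (0 : ℝ) < 1 by norm_num)] with s hs
  exact main s hs.1 hs.2

end Lip

/-- Gaussian concentration for 1-Lipschitz functions, for the standard Gaussian. -/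
lemma std_subgauss {d : ℕ} {F : EuclideanSpace ℝ (Fin d) → ℝ} (hL : LipschitzWith 1 F) :
    Integrable F (stdGaussian (EuclideanSpace ℝ (Fin d))) ∧
    HasSubgaussianMGF (fun x => F x - ∫ y, F y ∂(stdGaussian (EuclideanSpace ℝ (Fin d)))) 1
      (stdGaussian (EuclideanSpace ℝ (Fin d))) := by
  set γ := Measure.pi (fun _ : Fin d => gaussianReal 0 1) with hγ
  have hme : Measurable (WithLp.toLp 2 : (Fin d → ℝ) → EuclideanSpace ℝ (Fin d)) := by fun_prop
  have hFm : Measurable F := hL.continuous.measurable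
  have hF : Measurable (fun x : Fin d → ℝ => F (WithLp.toLp 2 x)) := hFm.comp hme
  have hL' : ∀ x y : Fin d → ℝ, (F (WithLp.toLp 2 x) - F (WithLp.toLp 2 y)) ^ 2 ≤
      ∑ i, (x i - y i) ^ 2 := by
    intro x y
    have h := hL.dist_le_mul (WithLp.toLp 2 x) (WithLp.toLp 2 y)
    rw [Real.dist_eq, NNReal.coe_one, one_mul, EuclideanSpace.dist_eq] at h
    have h2 := pow_le_pow_left₀ (abs_nonneg _) h 2
    rw [sq_abs, Real.sq_sqrt (by positivity)] at h2
    simpa [Real.dist_eq, sq_abs] using h2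
  have i1 := lip_int hF hL'
  have hI : ∫ y, F y ∂(stdGaussian (EuclideanSpace ℝ (Fin d))) =
      ∫ x, F (WithLp.toLp 2 x) ∂γ := by
    rw [← map_pi_eq_stdGaussian, integral_map hme.aemeasurable hFm.aestronglyMeasurable]
  refine ⟨?_, ?_, ?_⟩
  · rw [← map_pi_eq_stdGaussian, integrable_map_measure hFm.aestronglyMeasurable hme.aemeasurable]
    exact i1
  · intro t
    rw [hI, ← map_pi_eq_stdGaussian, integrable_map_measure
      (by fun_prop) hme.aemeasurable]
    have := (lip_int_exp hF hL' t).mul_const (Real.exp (- (t * ∫ x, F (WithLp.toLp 2 x) ∂γ)))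
    refine this.congr (Filter.Eventually.of_forall fun x => ?_)
    simp only [Function.comp_apply]
    rw [← Real.exp_add]; congr 1; ring
  · intro t
    rw [hI]
    simp_rw [sub_eq_add_neg]
    rw [mgf_add_const, mgf, ← map_pi_eq_stdGaussian, integral_map hme.aemeasurable
      (by fun_prop)]
    calc _ ≤ Real.exp (t * (∫ x, F (WithLp.toLp 2 x) ∂γ) + t ^ 2 / 2) *
          Real.exp (t * -∫ x, F (WithLp.toLp 2 x) ∂γ) := by
          gcongr
          exact lip_mgf hF hL' t
      _ = _ := by
          rw [← Real.exp_add]; congr 1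
          simp only [NNReal.coe_one]; ring

lemma subg_map_iff {E Ω' : Type*} [MeasurableSpace E] [MeasurableSpace Ω'] {P : Measure Ω'}
    {V : Ω' → E} (hV : Measurable V) {G : E → ℝ} (hG : Measurable G) :
    HasSubgaussianMGF G 1 (P.map V) ↔ HasSubgaussianMGF (G ∘ V) 1 P := by
  constructor
  · intro h
    refine ⟨fun t => ?_, fun t => ?_⟩
    · have := h.integrable_exp_mul t
      rwa [integrable_map_measure (by fun_prop) hV.aemeasurable] at this
    · rw [← mgf_map hV.aemeasurable (by fun_prop)]
      exact h.mgf_le t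
  · intro h
    refine ⟨fun t => ?_, fun t => ?_⟩
    · rw [integrable_map_measure (by fun_prop) hV.aemeasurable]
      exact h.integrable_exp_mul t
    · rw [mgf_map hV.aemeasurable (by fun_prop)]
      exact h.mgf_le t

lemma max_subgauss {N : ℕ} {Ω' : Type*} [MeasurableSpace Ω'] {P : Measure Ω'}
    [IsProbabilityMeasure P] (X : Fin (N + 1) → Ω' → ℝ) (hX : ∀ i, Measurable (X i))
    (hG : ∀ c : Fin (N + 1) → ℝ, ∃ v : NNReal,
      P.map (fun ω => ∑ i, c i * X i ω) = gaussianReal 0 v)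
    (hv : ∀ i, ∃ v : NNReal, v ≤ 1 ∧ P.map (X i) = gaussianReal 0 v) :
    Integrable (fun ω => Finset.univ.sup' Finset.univ_nonempty (fun i => X i ω)) P ∧
    HasSubgaussianMGF (fun ω => Finset.univ.sup' Finset.univ_nonempty (fun i => X i ω) -
      ∫ ω', Finset.univ.sup' Finset.univ_nonempty (fun i => X i ω') ∂P) 1 P := by
  set V : Ω' → EuclideanSpace ℝ (Fin (N + 1)) := fun ω => WithLp.toLp 2 (fun i => X i ω) with hVdef
  have hV : Measurable V := by
    have : Measurable (fun ω => (fun i => X i ω)) := measurable_pi_lambda _ hX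
    exact (by fun_prop : Measurable (WithLp.toLp 2 : (Fin (N + 1) → ℝ) → EuclideanSpace ℝ (Fin (N + 1)))).comp this
  set ν := P.map V with hν
  have : IsProbabilityMeasure ν := Measure.isProbabilityMeasure_map hV.aemeasurable
  have hLmap : ∀ L : EuclideanSpace ℝ (Fin (N + 1)) →L[ℝ] ℝ, ∃ v : NNReal,
      ν.map L = gaussianReal 0 v := by
    intro L
    obtain ⟨v, hv⟩ := hG (fun i => L (EuclideanSpace.basisFun _ ℝ i))
    refine ⟨v, ?_⟩
    rw [← hv, hν, Measure.map_map (by fun_prop) hV]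
    congr 1; ext ω
    have : V ω = ∑ i, X i ω • EuclideanSpace.basisFun (Fin (N + 1)) ℝ i := by
      have := (EuclideanSpace.basisFun (Fin (N + 1)) ℝ).sum_repr (V ω)
      rw [← this]; simp [hVdef]
    simp only [Function.comp_apply]
    rw [this, map_sum]
    simp [mul_comm]
  have hνG : IsGaussian ν := isGaussian_of_map_eq_gaussianReal fun L =>
    ⟨0, (hLmap L).choose, (hLmap L).choose_spec⟩
  set S : Matrix (Fin (N + 1)) (Fin (N + 1)) ℝ := Matrix.of fun i j =>
    covarianceBilin ν (EuclideanSpace.basisFun _ ℝ i) (EuclideanSpace.basisFun _ ℝ j) with hS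
  have hquad : ∀ t : EuclideanSpace ℝ (Fin (N + 1)),
      covarianceBilin ν t t = t ⬝ᵥ S.mulVec t := by
    intro t
    have ht : t = ∑ i, t i • EuclideanSpace.basisFun (Fin (N + 1)) ℝ i := by
      have := (EuclideanSpace.basisFun (Fin (N + 1)) ℝ).sum_repr t
      conv_lhs => rw [← this]
      simp
    conv_lhs => rw [ht]
    simp only [map_sum, map_smul, FunLike.coe_sum, Finset.sum_apply, FunLike.coe_smul, Pi.smul_apply,
      smul_eq_mul, dotProduct, Matrix.mulVec, hS, Matrix.of_apply, Finset.mul_sum]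
    rw [Finset.sum_comm]
    refine Finset.sum_congr rfl fun i _ => Finset.sum_congr rfl fun j _ => ?_
    ring
  have hPSD : S.PosSemidef := by
    refine Matrix.PosSemidef.of_dotProduct_mulVec_nonneg ?_ ?_
    · ext i j
      simp only [hS, Matrix.conjTranspose_apply, Matrix.of_apply, star_trivial]
      exact covarianceBilin_comm _ _
    · intro x
      have := hquad (WithLp.toLp 2 x)
      simp only [star_trivial]
      rw [← show (WithLp.toLp 2 x : EuclideanSpace ℝ (Fin (N + 1))).ofLp = x from rfl, ← this]
      exact covarianceBilin_self_nonneg _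
  have hνeq : ν = multivariateGaussian 0 S := by
    apply Measure.ext_of_charFun
    ext t
    rw [charFun_multivariateGaussian hPSD, IsGaussian.charFun_eq, ← hquad t,
      covarianceBilin_self IsGaussian.memLp_two_id]
    have : ∫ x, ⟪t, x⟫ ∂ν = 0 := by
      obtain ⟨v, hv⟩ := hLmap (innerSL ℝ t)
      have h2 : ∫ x, x ∂(ν.map (innerSL ℝ t)) = ∫ x, ⟪t, x⟫ ∂ν := by
        rw [integral_map (by fun_prop) (by fun_prop)]; rfl
      rw [← h2, hv, integral_id_gaussianReal]
    rw [integral_complex_ofReal, this]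
    simp
  obtain ⟨A, hνA⟩ : ∃ A : EuclideanSpace ℝ (Fin (N + 1)) →L[ℝ] EuclideanSpace ℝ (Fin (N + 1)),
      ν = (stdGaussian (EuclideanSpace ℝ (Fin (N + 1)))).map A := by
    rw [hνeq, multivariateGaussian]
    simp only [zero_add]
    exact ⟨_, rfl⟩
  set G : EuclideanSpace ℝ (Fin (N + 1)) → ℝ := fun y =>
    Finset.univ.sup' Finset.univ_nonempty (fun i => y i) with hGdef
  have hnorm : ∀ i, ‖(EuclideanSpace.proj i : EuclideanSpace ℝ (Fin (N + 1)) →L[ℝ] ℝ).comp A‖ ≤ 1 := by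
    intro i
    obtain ⟨v, hv1, hv⟩ := hv i
    have h1 := variance_dual_stdGaussian
      ((EuclideanSpace.proj i : EuclideanSpace ℝ (Fin (N + 1)) →L[ℝ] ℝ).comp A)
    have h2 : (stdGaussian (EuclideanSpace ℝ (Fin (N + 1)))).map
        ((EuclideanSpace.proj i : EuclideanSpace ℝ (Fin (N + 1)) →L[ℝ] ℝ).comp A) =
        gaussianReal 0 v := by
      rw [ContinuousLinearMap.coe_comp, ← Measure.map_map (by fun_prop) (by fun_prop), ← hνA, hν,
        Measure.map_map (by fun_prop) hV, ← hv]
      rfl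
    have h3 : Var[id; (stdGaussian (EuclideanSpace ℝ (Fin (N + 1)))).map
        ((EuclideanSpace.proj i : EuclideanSpace ℝ (Fin (N + 1)) →L[ℝ] ℝ).comp A)] = v := by
      rw [h2, variance_id_gaussianReal]
    rw [variance_id_map (by fun_prop), h1] at h3
    have : (v : ℝ) ≤ 1 := by exact_mod_cast hv1
    rw [← h3] at this
    exact (sq_le_one_iff₀ (norm_nonneg _)).1 this
  have hLip : LipschitzWith 1 (G ∘ A) := by
    apply LipschitzWith.of_le_add
    intro x y
    refine (Finset.sup'_le Finset.univ_nonempty (fun i => (A x) i) fun i _ => ?_ :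
      Finset.univ.sup' Finset.univ_nonempty (fun i => (A x) i) ≤ _)
    have h1 : A y i ≤ G (A y) := Finset.le_sup' (fun i => A y i) (Finset.mem_univ i)
    have h2 := ((EuclideanSpace.proj i : EuclideanSpace ℝ (Fin (N + 1)) →L[ℝ] ℝ).comp A).le_of_opNorm_le
      (hnorm i) (x - y)
    have h3 : A x i - A y i ≤ ‖x - y‖ := by
      refine (le_abs_self _).trans ?_
      simpa using h2
    rw [dist_eq_norm]
    simp only [Function.comp_apply]
    linarith
  have hGm : Measurable G := by
    have : Continuous G := by
      simp only [hGdef]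
      fun_prop
    exact this.measurable
  obtain ⟨hi, hsub⟩ := std_subgauss hLip
  have hiν : Integrable G ν := by
    rw [hνA, integrable_map_measure hGm.aestronglyMeasurable (by fun_prop)]
    exact hi
  have hE : ∫ y, (G ∘ A) y ∂(stdGaussian (EuclideanSpace ℝ (Fin (N + 1)))) = ∫ ω, G (V ω) ∂P := by
    rw [← integral_map hV.aemeasurable hGm.aestronglyMeasurable, ← hν, hνA,
      integral_map (by fun_prop) hGm.aestronglyMeasurable]
    rfl
  constructor
  · rw [hν, integrable_map_measure hGm.aestronglyMeasurable hV.aemeasurable] at hiν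
    exact hiν
  · rw [hE] at hsub
    have h1 := (subg_map_iff (P := stdGaussian (EuclideanSpace ℝ (Fin (N + 1)))) (V := A)
      (by fun_prop) (G := fun y => G y - ∫ ω, G (V ω) ∂P) (by fun_prop)).2 hsub
    rw [← hνA, hν, subg_map_iff hV (by fun_prop)] at h1
    exact h1

lemma count_tis {Ω' : Type*} [MeasurableSpace Ω'] {P : Measure Ω'}
    [IsProbabilityMeasure P] (X : ℕ → Ω' → ℝ) (hX : ∀ i, Measurable (X i))
    (hG : ∀ (N : ℕ) (c : Fin (N + 1) → ℝ), ∃ v : NNReal,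
      P.map (fun ω => ∑ i, c i * X i ω) = gaussianReal 0 v)
    (hv : ∀ i, ∃ v : NNReal, v ≤ 1 ∧ P.map (X i) = gaussianReal 0 v)
    (t : ℝ) (ht : 0 < t) :
    P {ω | (∫ ω', (⨆ k, X k ω') ∂P) + t < ⨆ k, X k ω} ≤ ENNReal.ofReal (Real.exp (-t ^ 2 / 2)) := by
  classical
  set S : ℕ → Ω' → ℝ := fun N ω =>
    (Finset.univ : Finset (Fin (N + 1))).sup' Finset.univ_nonempty (fun i => X i ω) with hS
  have hle : ∀ N (k : ℕ) ω, k ≤ N → X k ω ≤ S N ω := fun N k ω hk =>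
    Finset.le_sup' (fun i : Fin (N + 1) => X i ω) (Finset.mem_univ (⟨k, by omega⟩ : Fin (N + 1)))
  have hSle : ∀ N ω b, (∀ k ≤ N, X k ω ≤ b) → S N ω ≤ b := fun N ω b h =>
    Finset.sup'_le _ _ fun i _ => h i (by omega)
  have hmono : ∀ ω, Monotone (fun N => S N ω) := fun ω N M h =>
    hSle _ _ _ fun k hk => hle M k ω (hk.trans h)
  have hsub := fun N => max_subgauss (fun i : Fin (N + 1) => X i) (fun i => hX i) (hG N) (fun i => hv i)
  have hIntg : ∀ N, Integrable (S N) P := fun N => (hsub N).1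
  have hsg : ∀ N, HasSubgaussianMGF (fun ω => S N ω - ∫ ω', S N ω' ∂P) 1 P := fun N => (hsub N).2
  set E : ℕ → ℝ := fun N => ∫ ω', S N ω' ∂P with hE
  have hEmono : Monotone E := fun N M h => integral_mono (hIntg N) (hIntg M) fun ω => hmono ω h
  have hSm : ∀ N, Measurable (S N) := fun N => by
    have := Finset.measurable_sup' (s := (Finset.univ : Finset (Fin (N + 1)))) Finset.univ_nonempty
      (f := fun i => X i) (fun i _ => hX i)
    convert this using 1
    ext ω
    simp [hS, Finset.sup'_apply]
  by_cases hb : BddAbove (Set.range E)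
  · -- bounded expectations
    have htend : Filter.Tendsto E Filter.atTop (nhds (⨆ N, E N)) := tendsto_atTop_ciSup hEmono hb
    -- a.s. bounded
    have hX0i : Integrable (X 0) P := by
      refine (hIntg 0).congr (Filter.Eventually.of_forall fun ω => ?_)
      exact le_antisymm (hSle _ _ _ fun k hk => by simp [Nat.le_zero.1 hk]) (hle 0 0 ω le_rfl)
    have h1 : ∫⁻ ω, (⨆ N, ENNReal.ofReal (S N ω - X 0 ω)) ∂P ≤
        ENNReal.ofReal ((⨆ N, E N) - ∫ ω, X 0 ω ∂P) := by
      rw [lintegral_iSup (f := fun N ω => ENNReal.ofReal (S N ω - X 0 ω)) (fun N => ((hSm N).sub (hX 0)).ennreal_ofReal)]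
      · refine iSup_le fun N => ?_
        rw [← ofReal_integral_eq_lintegral_ofReal (f := fun a => S N a - X 0 a) ((hIntg N).sub hX0i)
          (Filter.Eventually.of_forall fun ω => sub_nonneg.2 (hle N 0 ω (Nat.zero_le _)))]
        apply ENNReal.ofReal_le_ofReal
        rw [integral_sub (hIntg N) hX0i]
        exact sub_le_sub_right (le_ciSup hb N) _
      · intro N M h ω
        exact ENNReal.ofReal_le_ofReal (sub_le_sub_right (hmono ω h) _)
    have hbdd : ∀ᵐ ω ∂P, BddAbove (Set.range fun k => X k ω) := by
      have h2 := ae_lt_top (μ := P) (f := fun ω => ⨆ N, ENNReal.ofReal (S N ω - X 0 ω))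
        (Measurable.iSup fun N => ((hSm N).sub (hX 0)).ennreal_ofReal)
        (h1.trans_lt ENNReal.ofReal_lt_top).ne
      filter_upwards [h2] with ω hω
      refine ⟨(⨆ N, ENNReal.ofReal (S N ω - X 0 ω)).toReal + X 0 ω, ?_⟩
      rintro _ ⟨k, rfl⟩
      have h3 : ENNReal.ofReal (S k ω - X 0 ω) ≤ ⨆ N, ENNReal.ofReal (S N ω - X 0 ω) :=
        le_iSup (fun N => ENNReal.ofReal (S N ω - X 0 ω)) k
      have h4 := (ENNReal.ofReal_le_iff_le_toReal hω.ne).1 h3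
      have h5 := hle k k ω le_rfl
      show X k ω ≤ _
      linarith
    have hconv : ∀ᵐ ω ∂P, Filter.Tendsto (fun N => S N ω) Filter.atTop (nhds (⨆ k, X k ω)) := by
      filter_upwards [hbdd] with ω hω
      have h1 : BddAbove (Set.range fun N => S N ω) := by
        obtain ⟨b, hb⟩ := hω
        exact ⟨b, by rintro _ ⟨N, rfl⟩; exact hSle _ _ _ fun k _ => hb ⟨k, rfl⟩⟩
      have h2 : (⨆ k, X k ω) = ⨆ N, S N ω := by
        apply le_antisymm
        · exact ciSup_le fun k => (hle k k ω le_rfl).trans (le_ciSup h1 k)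
        · exact ciSup_le fun N => hSle _ _ _ fun k _ => le_ciSup hω k
      rw [h2]
      exact tendsto_atTop_ciSup (hmono ω) h1
    have hSup_ge : ∀ N, ∀ᵐ ω ∂P, S N ω ≤ ⨆ k, X k ω := fun N => by
      filter_upwards [hbdd] with ω hω
      exact hSle _ _ _ fun k _ => le_ciSup hω k
    have hSupint : Integrable (fun ω => ⨆ k, X k ω) P := by
      have hmeas : AEStronglyMeasurable (fun ω => ⨆ k, X k ω) P :=
        aestronglyMeasurable_of_tendsto_ae Filter.atTop
          (fun N => (hSm N).aestronglyMeasurable) hconv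
      have hd : Integrable (fun ω => (⨆ k, X k ω) - X 0 ω) P := by
        refine ⟨hmeas.sub (hX 0).aestronglyMeasurable, ?_⟩
        rw [hasFiniteIntegral_iff_ofReal]
        · refine lt_of_le_of_lt (lintegral_mono_ae ?_) (h1.trans_lt ENNReal.ofReal_lt_top)
          filter_upwards [hconv] with ω hω
          refine le_of_tendsto (ENNReal.tendsto_ofReal (hω.sub_const (X 0 ω)))
            (Filter.Eventually.of_forall fun N => ?_)
          exact le_iSup (fun N => ENNReal.ofReal (S N ω - X 0 ω)) N
        · filter_upwards [hbdd] with ω hω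
          exact sub_nonneg.2 (le_ciSup hω 0)
      have := hd.add hX0i
      refine this.congr (Filter.Eventually.of_forall fun ω => ?_)
      simp
    have hEle : ∀ N, E N ≤ ∫ ω, (⨆ k, X k ω) ∂P := fun N =>
      integral_mono_ae (hIntg N) hSupint (hSup_ge N)
    have hev : ∀ N, P {ω | (∫ ω', (⨆ k, X k ω') ∂P) + t < S N ω} ≤
        ENNReal.ofReal (Real.exp (-t ^ 2 / 2)) := by
      intro N
      have h1 := (hsg N).measure_ge_le ht.le
      have h2 : P {ω | t ≤ S N ω - ∫ ω', S N ω' ∂P} ≤ ENNReal.ofReal (Real.exp (-t ^ 2 / 2)) := by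
        rw [← ofReal_measureReal]
        apply ENNReal.ofReal_le_ofReal
        simpa using h1
      refine (measure_mono ?_).trans h2
      intro ω hω
      have := hEle N
      simp only [Set.mem_ofPred_eq, hE] at *
      linarith
    have hae : {ω | (∫ ω', (⨆ k, X k ω') ∂P) + t < ⨆ k, X k ω} ≤ᵐ[P]
        ⋃ N, {ω | (∫ ω', (⨆ k, X k ω') ∂P) + t < S N ω} := by
      filter_upwards [hconv] with ω hω h
      obtain ⟨N, hN⟩ := (hω.eventually (lt_mem_nhds h)).exists
      exact Set.mem_iUnion.2 ⟨N, hN⟩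
    refine (measure_mono_ae hae).trans ?_
    rw [Monotone.measure_iUnion]
    · exact iSup_le hev
    · intro N M h ω hω
      exact lt_of_lt_of_le hω (hmono ω h)
  · -- unbounded expectations
    have hEtop : Filter.Tendsto E Filter.atTop Filter.atTop :=
      Filter.tendsto_atTop_atTop_of_monotone' hEmono hb
    have hnull : ∀ K : ℕ, P {ω | ∀ k, X k ω ≤ K} = 0 := by
      intro K
      have h1 : ∀ᶠ N in Filter.atTop, P {ω | ∀ k, X k ω ≤ K} ≤
          ENNReal.ofReal (Real.exp (-(E N - K) ^ 2 / 2)) := by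
        filter_upwards [hEtop.eventually_ge_atTop (K : ℝ)] with N hN
        have h2 := (hsg N).neg.measure_ge_le (sub_nonneg.2 hN)
        have h3 : P {ω | E N - K ≤ (-fun ω => S N ω - ∫ ω', S N ω' ∂P) ω} ≤
            ENNReal.ofReal (Real.exp (-(E N - K) ^ 2 / 2)) := by
          rw [← ofReal_measureReal]
          apply ENNReal.ofReal_le_ofReal
          simpa using h2
        refine (measure_mono ?_).trans h3
        intro ω hω
        have := hSle N ω K fun k _ => hω k
        simp only [Set.mem_ofPred_eq, hE, Pi.neg_apply] at *
        linarith
      have h4 : Filter.Tendsto (fun N => ENNReal.ofReal (Real.exp (-(E N - K) ^ 2 / 2)))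
          Filter.atTop (nhds 0) := by
        rw [← ENNReal.ofReal_zero]
        apply ENNReal.tendsto_ofReal
        apply Real.tendsto_exp_atBot.comp
        have h5 : Filter.Tendsto (fun N => E N - K) Filter.atTop Filter.atTop :=
          Filter.tendsto_atTop_add_const_right _ _ hEtop
        have h6 := (Filter.tendsto_pow_atTop (two_ne_zero)).comp h5
        have h7 := Filter.tendsto_neg_atTop_atBot.comp (h6.atTop_div_const (zero_lt_two))
        refine h7.congr fun N => ?_
        simp [neg_div]
      exact le_antisymm (ge_of_tendsto h4 h1) zero_le
    have hz : ∀ᵐ ω ∂P, (⨆ k, X k ω) = 0 := by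
      have := ae_all_iff.2 fun K : ℕ => measure_eq_zero_iff_ae_notMem.1 (hnull K)
      filter_upwards [this] with ω hω
      apply Real.iSup_of_not_bddAbove
      rintro ⟨b, hb⟩
      obtain ⟨K, hK⟩ := exists_nat_ge b
      exact hω K fun k => (hb ⟨k, rfl⟩).trans hK
    have h0 : ∫ ω, (⨆ k, X k ω) ∂P = 0 := by
      rw [integral_congr_ae hz]; simp
    rw [h0]
    have : P {ω | 0 + t < ⨆ k, X k ω} = 0 := by
      rw [measure_eq_zero_iff_ae_notMem]
      filter_upwards [hz] with ω hω
      simp only [Set.mem_ofPred_eq, hω]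
      linarith
    rw [this]; exact zero_le

lemma sup_seq {p : ℕ} (Ω U : Set (EuclideanSpace ℝ (Fin p))) (hne : Ω.Nonempty) (hU : U ⊆ Ω) :
    ∃ u : ℕ → EuclideanSpace ℝ (Fin p), (∀ k, u k ∈ Ω) ∧
      ∀ f : EuclideanSpace ℝ (Fin p) → ℝ, ContinuousOn f U → (∀ v ∈ Ω, v ∉ U → f v = 0) →
        (⨆ v : Ω, f v) = ⨆ k, f (u k) := by
  classical
  obtain ⟨D, hDU, hDc, hDd⟩ :=
    (TopologicalSpace.IsSeparable.of_separableSpace U).exists_countable_dense_subset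
  obtain ⟨D', hD'c, hDD', hD'Ω, hD'z, hD'ne⟩ : ∃ D' : Set (EuclideanSpace ℝ (Fin p)), D'.Countable ∧
      D ⊆ D' ∧ D' ⊆ Ω ∧ (∀ v ∈ Ω, v ∉ U → ∃ z ∈ D', z ∈ Ω ∧ z ∉ U) ∧ D'.Nonempty := by
    by_cases hz : ∃ z ∈ Ω, z ∉ U
    · obtain ⟨z, hz1, hz2⟩ := hz
      refine ⟨insert z D, hDc.insert z, Set.subset_insert _ _, ?_, ?_, ⟨z, Set.mem_insert _ _⟩⟩
      · exact Set.insert_subset hz1 (hDU.trans hU)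
      · exact fun _ _ _ => ⟨z, Set.mem_insert _ _, hz1, hz2⟩
    · push Not at hz
      refine ⟨D, hDc, subset_rfl, hDU.trans hU, fun v hv hvU => absurd (hz v hv) hvU, ?_⟩
      obtain ⟨v, hv⟩ := hne
      exact closure_nonempty_iff.1 ⟨v, hDd (hz v hv)⟩
  obtain ⟨u, hu⟩ := hD'c.exists_eq_range hD'ne
  have huΩ : ∀ k, u k ∈ Ω := fun k => hD'Ω (hu ▸ ⟨k, rfl⟩)
  refine ⟨u, huΩ, fun f hf h0 => ?_⟩
  have key : ∀ b, (∀ k, f (u k) ≤ b) → ∀ v ∈ Ω, f v ≤ b := by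
    intro b hb v hv
    have hb' : ∀ z ∈ D', f z ≤ b := by
      intro z hz
      rw [hu] at hz
      obtain ⟨k, rfl⟩ := hz
      exact hb k
    by_cases hvU : v ∈ U
    · have h1 := ((hf v hvU).mono hDU).mem_closure_image (hDd hvU)
      have h2 : closure (f '' D) ⊆ Set.Iic b := by
        apply closure_minimal _ isClosed_Iic
        rintro _ ⟨z, hz, rfl⟩
        exact hb' z (hDD' hz)
      exact h2 h1
    · obtain ⟨z, hz, hzΩ, hzU⟩ := hD'z v hv hvU
      rw [h0 v hv hvU, ← h0 z hzΩ hzU]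
      exact hb' z hz
  have : Nonempty Ω := hne.to_subtype
  by_cases hbd : BddAbove (Set.range fun k => f (u k))
  · have hbd2 : BddAbove (Set.range fun v : Ω => f v) := by
      obtain ⟨b, hb⟩ := hbd
      refine ⟨b, ?_⟩
      rintro _ ⟨v, rfl⟩
      exact key b (fun k => hb ⟨k, rfl⟩) v v.2
    apply le_antisymm
    · exact ciSup_le fun v => key _ (fun k => le_ciSup hbd k) v v.2
    · exact ciSup_le fun k => le_ciSup hbd2 (⟨u k, huΩ k⟩ : Ω)
  · have hbd2 : ¬ BddAbove (Set.range fun v : Ω => f v) := by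
      rintro ⟨b, hb⟩
      apply hbd
      refine ⟨b, ?_⟩
      rintro _ ⟨k, rfl⟩
      exact hb ⟨⟨u k, huΩ k⟩, rfl⟩
    rw [Real.iSup_of_not_bddAbove hbd, Real.iSup_of_not_bddAbove hbd2]

section Krig
variable {p n : ℕ} {Ψ Ψt : EuclideanSpace ℝ (Fin p) → ℝ}

lemma spec_int (h : IsSpectralDensity Ψ Ψt) (g : EuclideanSpace ℝ (Fin p) → ℝ) (hg : Continuous g)
    (b : ℝ) (hb : ∀ ω, |g ω| ≤ b) : Integrable (fun ω => g ω * Ψt ω) :=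
  h.2.1.bdd_mul hg.aestronglyMeasurable (Filter.Eventually.of_forall hb)

lemma spec_zero (h : IsSpectralDensity Ψ Ψt) : Ψ 0 = 1 := by
  rw [h.2.2.2 0]; simp [h.2.2.1]

lemma spec_even (h : IsSpectralDensity Ψ Ψt) (v w : EuclideanSpace ℝ (Fin p)) :
    Ψ (v - w) = Ψ (w - v) := by
  rw [h.2.2.2, h.2.2.2]
  congr 1; ext ω
  rw [← neg_sub w v, inner_neg_right, Real.cos_neg]

lemma spec_cont (h : IsSpectralDensity Ψ Ψt) : Continuous Ψ := by
  have : Ψ = fun v => ∫ ω, Real.cos ⟪ω, v⟫ * Ψt ω := funext h.2.2.2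
  rw [this]
  refine continuous_of_dominated (bound := Ψt) ?_ ?_ h.2.1 ?_
  · intro v
    exact (spec_int h _ (by fun_prop) 1 (fun ω => Real.abs_cos_le_one _)).aestronglyMeasurable
  · intro v
    refine Filter.Eventually.of_forall fun ω => ?_
    rw [Real.norm_eq_abs, abs_mul, abs_of_nonneg (h.1 ω)]
    exact mul_le_of_le_one_left (h.1 ω) (Real.abs_cos_le_one _)
  · refine Filter.Eventually.of_forall fun ω => ?_
    fun_prop

lemma spec_psd (h : IsSpectralDensity Ψ Ψt) {m : ℕ} (c : Fin m → ℝ)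
    (y : Fin m → EuclideanSpace ℝ (Fin p)) : 0 ≤ ∑ i, ∑ j, c i * c j * Ψ (y i - y j) := by
  have h1 : ∑ i, ∑ j, c i * c j * Ψ (y i - y j) =
      ∫ ω, ∑ i, ∑ j, c i * c j * (Real.cos ⟪ω, y i - y j⟫ * Ψt ω) := by
    have hi : ∀ i j, Integrable (fun ω => c i * c j * (Real.cos ⟪ω, y i - y j⟫ * Ψt ω)) :=
      fun i j => (spec_int h _ (by fun_prop) 1 (fun ω => Real.abs_cos_le_one _)).const_mul _
    rw [integral_finsetSum _ fun i _ => integrable_finsetSum _ fun j _ => hi i j]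
    refine Finset.sum_congr rfl fun i _ => ?_
    rw [integral_finsetSum _ fun j _ => hi i j]
    refine Finset.sum_congr rfl fun j _ => ?_
    rw [integral_const_mul, ← h.2.2.2]
  rw [h1]
  refine integral_nonneg fun ω => ?_
  have h2 : ∑ i, ∑ j, c i * c j * (Real.cos ⟪ω, y i - y j⟫ * Ψt ω) =
      ((∑ i, c i * Real.cos ⟪ω, y i⟫) ^ 2 + (∑ i, c i * Real.sin ⟪ω, y i⟫) ^ 2) * Ψt ω := by
    rw [sq, sq, Finset.sum_mul_sum, Finset.sum_mul_sum, ← Finset.sum_add_distrib, Finset.sum_mul]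
    refine Finset.sum_congr rfl fun i _ => ?_
    rw [← Finset.sum_add_distrib, Finset.sum_mul]
    refine Finset.sum_congr rfl fun j _ => ?_
    rw [inner_sub_right, Real.cos_sub]; ring
  show 0 ≤ ∑ i, ∑ j, c i * c j * (Real.cos ⟪ω, y i - y j⟫ * Ψt ω)
  rw [h2]
  exact mul_nonneg (by positivity) (h.1 ω)

/-- kriging weights -/
noncomputable def kwt (Ψ : EuclideanSpace ℝ (Fin p) → ℝ) (xs : Fin n → EuclideanSpace ℝ (Fin p))
    (v : EuclideanSpace ℝ (Fin p)) (k : Fin n) : ℝ := ∑ j, Ψ (v - xs j) * (kmat Ψ xs)⁻¹ j k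

/-- explained variance -/
noncomputable def kq (Ψ : EuclideanSpace ℝ (Fin p) → ℝ) (xs : Fin n → EuclideanSpace ℝ (Fin p))
    (v : EuclideanSpace ℝ (Fin p)) : ℝ :=
  ∑ j, ∑ k, Ψ (v - xs j) * (kmat Ψ xs)⁻¹ j k * Ψ (v - xs k)

lemma kinterp_eq (xs : Fin n → EuclideanSpace ℝ (Fin p)) (f : EuclideanSpace ℝ (Fin p) → ℝ)
    (v : EuclideanSpace ℝ (Fin p)) : kinterp Ψ xs f v = ∑ k, kwt Ψ xs v k * f (xs k) := by
  rw [kinterp, Finset.sum_comm]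
  simp only [kwt, Finset.sum_mul]

lemma kq_eq (xs : Fin n → EuclideanSpace ℝ (Fin p))
    (v : EuclideanSpace ℝ (Fin p)) : kq Ψ xs v = ∑ k, kwt Ψ xs v k * Ψ (v - xs k) := by
  rw [kq, Finset.sum_comm]
  simp only [kwt, Finset.sum_mul]

lemma kwt_mul (xs : Fin n → EuclideanSpace ℝ (Fin p)) (hK : IsUnit (kmat Ψ xs).det)
    (v : EuclideanSpace ℝ (Fin p)) (l : Fin n) :
    ∑ k, kwt Ψ xs v k * Ψ (xs k - xs l) = Ψ (v - xs l) := by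
  have h1 : Matrix.vecMul (Matrix.vecMul (fun j => Ψ (v - xs j)) (kmat Ψ xs)⁻¹) (kmat Ψ xs) =
      fun j => Ψ (v - xs j) := by
    rw [Matrix.vecMul_vecMul, Matrix.nonsing_inv_mul _ hK, Matrix.vecMul_one]
  exact congrFun h1 l

lemma kq_eq2 (xs : Fin n → EuclideanSpace ℝ (Fin p)) (hK : IsUnit (kmat Ψ xs).det)
    (v : EuclideanSpace ℝ (Fin p)) :
    ∑ i, ∑ j, kwt Ψ xs v i * kwt Ψ xs v j * Ψ (xs i - xs j) = kq Ψ xs v := by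
  rw [Finset.sum_comm, kq_eq]
  refine Finset.sum_congr rfl fun j _ => ?_
  rw [← kwt_mul xs hK v j, Finset.mul_sum]
  exact Finset.sum_congr rfl fun i _ => by ring

lemma kq_nonneg (h : IsSpectralDensity Ψ Ψt) (xs : Fin n → EuclideanSpace ℝ (Fin p))
    (hK : IsUnit (kmat Ψ xs).det) (v : EuclideanSpace ℝ (Fin p)) : 0 ≤ kq Ψ xs v := by
  rw [← kq_eq2 xs hK v]; exact spec_psd h _ _

lemma krigSd_nonneg (xs : Fin n → EuclideanSpace ℝ (Fin p)) {σ : ℝ} (hσ : 0 < σ)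
    (v : EuclideanSpace ℝ (Fin p)) : 0 ≤ krigSd Ψ xs σ v :=
  mul_nonneg hσ.le (Real.sqrt_nonneg _)

lemma krigSd_le (h : IsSpectralDensity Ψ Ψt) (xs : Fin n → EuclideanSpace ℝ (Fin p))
    (hK : IsUnit (kmat Ψ xs).det) {σ : ℝ} (hσ : 0 < σ) (v : EuclideanSpace ℝ (Fin p)) :
    krigSd Ψ xs σ v ≤ σ := by
  refine mul_le_of_le_one_right hσ.le ?_
  have := kq_nonneg h xs hK v
  rw [kq] at this
  exact Real.sqrt_le_iff.2 ⟨zero_le_one, by linarith⟩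

lemma one_le_log (h : IsSpectralDensity Ψ Ψt) (xs : Fin n → EuclideanSpace ℝ (Fin p))
    (hK : IsUnit (kmat Ψ xs).det) {σ : ℝ} (hσ : 0 < σ) (v : EuclideanSpace ℝ (Fin p))
    (hv : 0 < krigSd Ψ xs σ v) : 1 ≤ Real.log (Real.exp 1 * σ / krigSd Ψ xs σ v) := by
  rw [Real.le_log_iff_exp_le (by positivity), le_div_iff₀ hv]
  exact mul_le_mul_of_nonneg_left (krigSd_le h xs hK hσ v) (Real.exp_pos 1).le

/-- coefficient vector of the residual -/
noncomputable def kco (Ψ : EuclideanSpace ℝ (Fin p) → ℝ) (xs : Fin n → EuclideanSpace ℝ (Fin p))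
    (σ : ℝ) (v : EuclideanSpace ℝ (Fin p)) (i : Fin (n + 1)) : ℝ :=
  (krigSd Ψ xs σ v * Real.sqrt (Real.log (Real.exp 1 * σ / krigSd Ψ xs σ v)))⁻¹ *
    (Fin.cons 1 (fun k => - kwt Ψ xs v k) : Fin (n + 1) → ℝ) i

/-- points of the residual -/
def kpt (xs : Fin n → EuclideanSpace ℝ (Fin p)) (v : EuclideanSpace ℝ (Fin p)) :
    Fin (n + 1) → EuclideanSpace ℝ (Fin p) := Fin.cons v xs

lemma krigRatio_eq (xs : Fin n → EuclideanSpace ℝ (Fin p)) (σ : ℝ)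
    (f : EuclideanSpace ℝ (Fin p) → ℝ) (v : EuclideanSpace ℝ (Fin p)) :
    krigRatio Ψ xs σ f v = ∑ i, kco Ψ xs σ v i * f (kpt xs v i) := by
  rw [krigRatio, kinterp_eq, Fin.sum_univ_succ]
  simp only [kco, kpt, Fin.cons_zero, Fin.cons_succ, mul_assoc]
  rw [← Finset.mul_sum, ← mul_add, div_eq_inv_mul]
  simp [sub_eq_add_neg]

lemma kvar_eq (h : IsSpectralDensity Ψ Ψt) (xs : Fin n → EuclideanSpace ℝ (Fin p))
    (hK : IsUnit (kmat Ψ xs).det) (v : EuclideanSpace ℝ (Fin p)) :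
    ∑ i, ∑ j, (Fin.cons 1 (fun k => - kwt Ψ xs v k) : Fin (n + 1) → ℝ) i *
      (Fin.cons 1 (fun k => - kwt Ψ xs v k) : Fin (n + 1) → ℝ) j * Ψ (kpt xs v i - kpt xs v j) =
      1 - kq Ψ xs v := by
  have h2 := kq_eq2 xs hK v
  have h3 := kq_eq (Ψ := Ψ) xs v
  simp only [Fin.sum_univ_succ, kpt, Fin.cons_zero, Fin.cons_succ, sub_self, spec_zero h,
    Finset.sum_add_distrib, spec_even h (xs _) v]
  simp only [neg_mul, mul_neg, one_mul, mul_one, neg_neg, Finset.sum_neg_distrib, h2, ← h3]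
  ring

lemma kvar_le (h : IsSpectralDensity Ψ Ψt) (xs : Fin n → EuclideanSpace ℝ (Fin p))
    (hK : IsUnit (kmat Ψ xs).det) {σ : ℝ} (hσ : 0 < σ) (v : EuclideanSpace ℝ (Fin p)) :
    ∑ i, ∑ j, kco Ψ xs σ v i * kco Ψ xs σ v j * (σ ^ 2 * Ψ (kpt xs v i - kpt xs v j)) ≤ 1 := by
  have h1 : ∑ i, ∑ j, kco Ψ xs σ v i * kco Ψ xs σ v j * (σ ^ 2 * Ψ (kpt xs v i - kpt xs v j)) =
      (krigSd Ψ xs σ v * Real.sqrt (Real.log (Real.exp 1 * σ / krigSd Ψ xs σ v)))⁻¹ ^ 2 *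
        (σ ^ 2 * (1 - kq Ψ xs v)) := by
    rw [← kvar_eq h xs hK v]
    simp only [Finset.mul_sum, kco]
    exact Finset.sum_congr rfl fun i _ => Finset.sum_congr rfl fun j _ => by ring
  rw [h1]
  rcases (krigSd_nonneg (Ψ := Ψ) xs hσ v).eq_or_lt with h0 | h0
  · rw [← h0]; simp
  · have hl := one_le_log h xs hK hσ v h0
    have hq : 0 < 1 - kq Ψ xs v := by
      by_contra hc
      have : krigSd Ψ xs σ v = 0 := by
        rw [krigSd, ← kq, Real.sqrt_eq_zero_of_nonpos (not_lt.1 hc), mul_zero]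
      exact h0.ne' this
    have hs : σ ^ 2 * (1 - kq Ψ xs v) = krigSd Ψ xs σ v ^ 2 := by
      rw [krigSd, ← kq, mul_pow, Real.sq_sqrt hq.le]
    rw [hs, mul_inv, mul_pow, inv_pow, inv_pow, Real.sq_sqrt (by linarith)]
    have : (krigSd Ψ xs σ v ^ 2) ≠ 0 := by positivity
    rw [mul_right_comm, inv_mul_cancel₀ this, one_mul]
    exact inv_le_one_of_one_le₀ hl

lemma kcont (h : IsSpectralDensity Ψ Ψt) (xs : Fin n → EuclideanSpace ℝ (Fin p))
    (hK : IsUnit (kmat Ψ xs).det) {σ : ℝ} (hσ : 0 < σ) (Ω : Set (EuclideanSpace ℝ (Fin p)))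
    (f : EuclideanSpace ℝ (Fin p) → ℝ) (hf : ContinuousOn f Ω) :
    ContinuousOn (krigRatio Ψ xs σ f) {v | v ∈ Ω ∧ 0 < krigSd Ψ xs σ v} := by
  have hΨ := spec_cont h
  have hsd : Continuous (krigSd Ψ xs σ) := by unfold krigSd; fun_prop
  have hin : Continuous (kinterp Ψ xs f) := by unfold kinterp; fun_prop
  have hlog : ContinuousOn (fun v => Real.log (Real.exp 1 * σ / krigSd Ψ xs σ v))
      {v | v ∈ Ω ∧ 0 < krigSd Ψ xs σ v} := by
    apply ContinuousOn.log
    · exact continuousOn_const.div hsd.continuousOn fun v hv => hv.2.ne'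
    · intro v hv
      have := hv.2
      positivity
  unfold krigRatio
  refine ContinuousOn.div ((hf.mono fun v hv => hv.1).sub hin.continuousOn)
    (hsd.continuousOn.mul hlog.sqrt) ?_
  intro v hv
  have h1 := one_le_log h xs hK hσ v hv.2
  exact mul_ne_zero hv.2.ne' (Real.sqrt_pos.2 (by linarith)).ne'

end Krig

/-- Theorem 1, Part 2 of the paper: concentration of
`M = sup_{x∈Ω} (Z(x) − μ(x))/(σ(x) log^{1/2}(eσ/σ(x)))` (convention 0/0 = 0) around its
mean: for every t > 0, `P(M − E[M] > t) ≤ e^{−t²/2}`. -/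
theorem stmt1 (p : ℕ) (hp : 0 < p)
    (Ω : Set (EuclideanSpace ℝ (Fin p))) (hΩc : IsCompact Ω) (hΩne : Ω.Nonempty)
    (hΩd : 0 < Metric.diam Ω)
    (Ψ Ψt : EuclideanSpace ℝ (Fin p) → ℝ) (hspec : IsSpectralDensity Ψ Ψt)
    (hA0 : Integrable (fun ω => (∑ i, |ω i|) * Ψt ω))
    (σ : ℝ) (hσ : 0 < σ)
    (Ω' : Type) [MeasurableSpace Ω'] (P : Measure Ω') [IsProbabilityMeasure P]
    (Z : EuclideanSpace ℝ (Fin p) → Ω' → ℝ) (hZmeas : ∀ x, Measurable (Z x))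
    (hZcont : ∀ᵐ ω' ∂P, ContinuousOn (fun x => Z x ω') Ω)
    (hgauss : GaussCov P Z σ Ψ)
    (n : ℕ) (xs : Fin n → EuclideanSpace ℝ (Fin p)) (hxs : ∀ i, xs i ∈ Ω)
    (hK : IsUnit (kmat Ψ xs).det)
    (t : ℝ) (ht : 0 < t) :
    P {ω' | (∫ ω'', (⨆ v : Ω, krigRatio Ψ xs σ (fun x => Z x ω'') v) ∂P) + t <
        ⨆ v : Ω, krigRatio Ψ xs σ (fun x => Z x ω') v} ≤
      ENNReal.ofReal (Real.exp (-t ^ 2 / 2)) := by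
  classical
  obtain ⟨u, huΩ, hu⟩ := sup_seq Ω {v | v ∈ Ω ∧ 0 < krigSd Ψ xs σ v} hΩne (fun v hv => hv.1)
  have hsup : ∀ᵐ ω' ∂P, (⨆ v : Ω, krigRatio Ψ xs σ (fun x => Z x ω') v) =
      ⨆ k, krigRatio Ψ xs σ (fun x => Z x ω') (u k) := by
    filter_upwards [hZcont] with ω' hω'
    refine hu _ (kcont hspec xs hK hσ Ω _ hω') ?_
    intro v hv hvU
    have h0 : krigSd Ψ xs σ v = 0 := by
      by_contra hc
      exact hvU ⟨hv, lt_of_le_of_ne (krigSd_nonneg xs hσ v) (Ne.symm hc)⟩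
    simp [krigRatio, h0]
  have hmain := count_tis (P := P) (fun k ω' => krigRatio Ψ xs σ (fun x => Z x ω') (u k)) ?_ ?_ ?_ t ht
  · refine le_trans (measure_mono_ae ?_) hmain
    filter_upwards [hsup] with ω' hω' hlt
    have hlt' : (∫ ω'', (⨆ v : Ω, krigRatio Ψ xs σ (fun x => Z x ω'') v) ∂P) + t <
        ⨆ v : Ω, krigRatio Ψ xs σ (fun x => Z x ω') v := hlt
    rw [integral_congr_ae hsup, hω'] at hlt'
    exact hlt'
  · intro k
    simp only [krigRatio_eq]
    exact Finset.measurable_sum _ fun i _ => (hZmeas _).const_mul _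
  · intro N c
    have h1 := hgauss ((N + 1) * (n + 1))
      (fun e => c (finProdFinEquiv.symm e).1 *
        kco Ψ xs σ (u (finProdFinEquiv.symm e).1) (finProdFinEquiv.symm e).2)
      (fun e => kpt xs (u (finProdFinEquiv.symm e).1) (finProdFinEquiv.symm e).2)
    refine ⟨_, Eq.trans ?_ h1⟩
    congr 1
    ext ω'
    rw [Equiv.sum_comp (finProdFinEquiv (m := N + 1) (n := n + 1)).symm (fun q => c q.1 * kco Ψ xs σ (u q.1) q.2 *
      Z (kpt xs (u q.1) q.2) ω'), Fintype.sum_prod_type]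
    refine Finset.sum_congr rfl fun i _ => ?_
    rw [krigRatio_eq, Finset.mul_sum]
    exact Finset.sum_congr rfl fun j _ => by ring
  · intro k
    have h1 := hgauss (n + 1) (kco Ψ xs σ (u k)) (kpt xs (u k))
    refine ⟨_, ?_, Eq.trans ?_ h1⟩
    · exact Real.toNNReal_le_one.2 (kvar_le hspec xs hK hσ (u k))
    · simp only [krigRatio_eq]
end
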